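/- arXiv:2503.11779 — 2 statements merged into one kernel-verified Lean document; each statement's English description precedes it below -/
import Mathlib

section
/- Let L > 0, let κ : ℝ → ℝ be a smooth function and let II⁰ : ℝ → ℝ^{2×2} be a smooth map with II⁰(z₁) symmetric for every z₁. Then there exist w > 0, C > 0 and a smooth map Φ : (0,L)×(−w/2,w/2) → ℝ³ such that: (i) ∂₁Φ(z) × ∂₂Φ(z) ≠ 0 at every point z; (ii) the first fundamental form satisfies ‖(DΦᵀDΦ)(z₁,z₂) − [[(1−κ(z₁)z₂)² − det(II⁰(z₁))·z₂², 0],[0, 1]]‖ ≤ C|z₂|³ for all (z₁,z₂) in the domain; and (iii) the second fundamental form satisfies ‖II_Φ(z₁,z₂) − II⁰(z₁)‖ ≤ C|z₂| for all (z₁,z₂) in the domain. -/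
open Matrix

/-- The standard basis of ℝ² (as pairs). -/
noncomputable def E2 : Fin 2 → ℝ × ℝ := ![(1, 0), (0, 1)]

/-- The `i`-th partial derivative of a map `ℝ² → ℝ³`. -/
noncomputable def pdv (i : Fin 2) (f : ℝ × ℝ → Fin 3 → ℝ) (z : ℝ × ℝ) : Fin 3 → ℝ :=
  fderiv ℝ f z (E2 i)

/-- The cross product in ℝ³. -/
def cross3 (u v : Fin 3 → ℝ) : Fin 3 → ℝ :=
  ![u 1 * v 2 - u 2 * v 1, u 2 * v 0 - u 0 * v 2, u 0 * v 1 - u 1 * v 0]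

/-- The Euclidean norm on ℝ³. -/
noncomputable def norm3 (u : Fin 3 → ℝ) : ℝ := Real.sqrt (∑ i, u i ^ 2)

/-- The unit normal `ν_f = (∂₁f × ∂₂f)/|∂₁f × ∂₂f|` of a map `f : ℝ² → ℝ³`. -/
noncomputable def nuv (f : ℝ × ℝ → Fin 3 → ℝ) (z : ℝ × ℝ) : Fin 3 → ℝ :=
  (norm3 (cross3 (pdv 0 f z) (pdv 1 f z)))⁻¹ • cross3 (pdv 0 f z) (pdv 1 f z)

/-- The first fundamental form `(DΦᵀDΦ)_{ij} = ∂_i f · ∂_j f` of a map `f : ℝ² → ℝ³`. -/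
noncomputable def firstFF (f : ℝ × ℝ → Fin 3 → ℝ) (z : ℝ × ℝ) :
    Matrix (Fin 2) (Fin 2) ℝ :=
  Matrix.of fun i j => pdv i f z ⬝ᵥ pdv j f z

/-- The second fundamental form `(II_f)_{ij} = ∂_i∂_j f · ν_f` of a map `f : ℝ² → ℝ³`. -/
noncomputable def secondFF (f : ℝ × ℝ → Fin 3 → ℝ) (z : ℝ × ℝ) :
    Matrix (Fin 2) (Fin 2) ℝ :=
  Matrix.of fun i j => pdv i (pdv j f) z ⬝ᵥ nuv f z

/-- The Frobenius norm of a real 2×2 matrix. -/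
noncomputable def frob2 (A : Matrix (Fin 2) (Fin 2) ℝ) : ℝ :=
  Real.sqrt (∑ i, ∑ j, A i j ^ 2)


lemma ode_exists_aux {E : Type*} [NormedAddCommGroup E] [NormedSpace ℝ E] [FiniteDimensional ℝ E]
    (L : ℝ) (hL : 0 < L) (f : ℝ × E → E) (hf : ContDiff ℝ (⊤ : ℕ∞) f) (M : ℝ)
    (hM : ∀ t ∈ Set.Icc (-1) (L + 1), ∀ x, ‖f (t, x)‖ ≤ M) (x0 : E) :
    ∃ α : ℝ → E, α 0 = x0 ∧ ContDiffOn ℝ (⊤ : ℕ∞) α (Set.Icc (-1) (L + 1)) ∧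
      ∀ t ∈ Set.Ioo (-1) (L + 1), HasDerivAt α (f (t, α t)) t := by
  have h0 : (0 : ℝ) ∈ Set.Icc (-1) (L + 1) := ⟨by linarith, by linarith⟩
  have hM0 : 0 ≤ M := (norm_nonneg _).trans (hM 0 h0 x0)
  let a : NNReal := ⟨M * (L + 1), by positivity⟩
  obtain ⟨K, hK⟩ := LocallyLipschitzOn.exists_lipschitzOnWith_of_compact
    ((isCompact_Icc (a := (-1 : ℝ)) (b := L + 1)).prod (isCompact_closedBall x0 a))
    ((hf.of_le (by norm_cast) : ContDiff ℝ 1 f).locallyLipschitz.locallyLipschitzOn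
      (s := Set.Icc (-1) (L + 1) ×ˢ Metric.closedBall x0 a))
  have hpl : IsPicardLindelof (fun t x => f (t, x)) (⟨0, h0⟩ : Set.Icc (-1) (L + 1)) x0
      a 0 ⟨M, hM0⟩ K := by
    refine ⟨?_, ?_, ?_, ?_⟩
    · intro t ht
      have := hK.comp (f := fun x : E => (t, x)) (s := Metric.closedBall x0 a)
        (LipschitzWith.prodMk_left t |>.lipschitzOnWith) (fun x hx => ⟨ht, hx⟩)
      simpa using! this
    · intro x _
      have := hf.continuous
      fun_prop
    · intro t ht x _
      exact hM t ht x
    · have : max (L + 1 - 0) (0 - (-1 : ℝ)) = L + 1 := by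
        rw [max_eq_left] <;> linarith
      simp only [this]
      rw [NNReal.coe_zero, sub_zero]
      exact le_refl (M * (L + 1))
  obtain ⟨α, h1, h2⟩ := hpl.exists_eq_forall_mem_Icc_hasDerivWithinAt₀
  refine ⟨α, h1, ?_, ?_⟩
  · exact ODE.contDiffOn_enat_Icc_of_hasDerivWithinAt (u := Set.univ) (f := fun t x => f (t, x))
      hf.contDiffOn h2 (Set.mapsTo_univ _ _)
  · intro t ht
    exact (h2 t ⟨ht.1.le, ht.2.le⟩).hasDerivAt (Icc_mem_nhds ht.1 ht.2)

lemma frame_exists_aux (L : ℝ) (hL : 0 < L) (A : ℝ → Fin 3 → Fin 3 → ℝ)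
    (hA : ∀ i j, ContDiff ℝ (⊤ : ℕ∞) (fun t => A t i j)) (hanti : ∀ t i j, A t i j = - A t j i) :
    ∃ X : ℝ → Matrix (Fin 3) (Fin 3) ℝ, (∀ i j, ContDiff ℝ (⊤ : ℕ∞) (fun t => X t i j)) ∧
      ∀ t ∈ Set.Ioo 0 L, (∀ i k, HasDerivAt (fun s => X s i k) (∑ j, A t i j * X t j k) t) ∧
        X t * (X t)ᵀ = 1 ∧ (X t).det = 1 := by
  let f : ℝ × (Fin 3 → Fin 3 → ℝ) → (Fin 3 → Fin 3 → ℝ) := fun p i k =>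
    ∑ j, A p.1 i j * (4 / (1 + ∑ a, ∑ b, p.2 a b ^ 2) * p.2 j k)
  have hpos : ∀ Y : Fin 3 → Fin 3 → ℝ, 0 < 1 + ∑ a, ∑ b, Y a b ^ 2 := fun Y => by positivity
  have hf : ContDiff ℝ (⊤ : ℕ∞) f := by
    rw [contDiff_pi]; intro i
    rw [contDiff_pi]; intro k
    refine ContDiff.sum fun j _ => ?_
    refine ((hA i j).comp contDiff_fst).mul (ContDiff.mul (ContDiff.div contDiff_const ?_
      (fun p => (hpos _).ne')) ?_) <;> fun_prop
  have hbd : ∀ i j, ∃ M, ∀ t ∈ Set.Icc (-1) (L + 1), |A t i j| ≤ M := fun i j => by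
    obtain ⟨M, hM⟩ := isCompact_Icc.exists_bound_of_continuousOn
      (hA i j).continuous.continuousOn (s := Set.Icc (-1) (L + 1))
    exact ⟨M, hM⟩
  choose M hM using hbd
  have hM0 : ∀ i j, 0 ≤ M i j := fun i j => (abs_nonneg _).trans
    (hM i j 0 ⟨by linarith, by linarith⟩)
  have hfb : ∀ t ∈ Set.Icc (-1) (L + 1), ∀ x, ‖f (t, x)‖ ≤ ∑ i, ∑ j, M i j * 4 := by
    intro t ht x
    have hs : 0 ≤ ∑ i, ∑ j, M i j * 4 :=
      Finset.sum_nonneg fun i _ => Finset.sum_nonneg fun j _ => by have := hM0 i j; positivity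
    rw [pi_norm_le_iff_of_nonneg hs]; intro i
    rw [pi_norm_le_iff_of_nonneg hs]; intro k
    have h1 : ‖f (t, x) i k‖ ≤ ∑ j, M i j * 4 := by
      refine (norm_sum_le _ _).trans (Finset.sum_le_sum fun j _ => ?_)
      rw [norm_mul]
      refine mul_le_mul (hM i j t ht) ?_ (norm_nonneg _) (hM0 i j)
      rw [Real.norm_eq_abs, abs_le]
      have hp := hpos x
      have hle : x j k ^ 2 ≤ ∑ a, ∑ b, x a b ^ 2 :=
        (Finset.single_le_sum (f := fun b => x j b ^ 2) (fun b _ => sq_nonneg _)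
          (Finset.mem_univ k)).trans
        (Finset.single_le_sum (f := fun a => ∑ b, x a b ^ 2)
          (fun a _ => Finset.sum_nonneg fun b _ => sq_nonneg _) (Finset.mem_univ j))
      rw [div_mul_eq_mul_div]
      constructor
      · rw [le_div_iff₀ hp]
        nlinarith [sq_nonneg (x j k + 1)]
      · rw [div_le_iff₀ hp]
        nlinarith [sq_nonneg (x j k - 1)]
    exact h1.trans (Finset.single_le_sum (f := fun i => ∑ j, M i j * 4)
      (fun i _ => Finset.sum_nonneg fun j _ => by have := hM0 i j; positivity) (Finset.mem_univ i))
  obtain ⟨α, h0, hsm, hder⟩ := ode_exists_aux L hL f hf _ hfb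
    (fun i j => (1 : Matrix (Fin 3) (Fin 3) ℝ) i j)
  have hder' : ∀ t ∈ Set.Ioo (-1) (L + 1), ∀ i k,
      HasDerivAt (fun s => α s i k) (f (t, α t) i k) t := by
    intro t ht i k
    exact hasDerivAt_pi.1 (hasDerivAt_pi.1 (hder t ht) i) k
  have h0mem : (0 : ℝ) ∈ Set.Ioo (-1) (L + 1) := ⟨by linarith, by linarith⟩
  have hconst : ∀ g : ℝ → ℝ, (∀ t ∈ Set.Ioo (-1) (L + 1), HasDerivAt g 0 t) →
      ∀ t ∈ Set.Ioo (-1) (L + 1), g t = g 0 := by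
    intro g hg t ht
    exact isOpen_Ioo.is_const_of_deriv_eq_zero isPreconnected_Ioo
      (fun s hs => (hg s hs).differentiableAt.differentiableWithinAt)
      (fun s hs => (hg s hs).deriv) ht h0mem
  have hA0 : ∀ t, A t 0 0 = 0 ∧ A t 1 1 = 0 ∧ A t 2 2 = 0 ∧ A t 1 0 = - A t 0 1 ∧
      A t 2 0 = - A t 0 2 ∧ A t 2 1 = - A t 1 2 := by
    intro t
    refine ⟨?_, ?_, ?_, hanti _ _ _, hanti _ _ _, hanti _ _ _⟩
    · linarith [hanti t 0 0]
    · linarith [hanti t 1 1]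
    · linarith [hanti t 2 2]
  have hgram : ∀ t ∈ Set.Ioo (-1) (L + 1), ∀ k l, ∑ i, α t i k * α t i l = (1 : Matrix (Fin 3) (Fin 3) ℝ) k l := by
    intro t ht k l
    have := hconst (fun s => ∑ i, α s i k * α s i l) (fun s hs => by
      have h := HasDerivAt.fun_sum (u := Finset.univ) fun (i : Fin 3) _ => (hder' s hs i k).mul (hder' s hs i l)
      refine h.congr_deriv ?_
      obtain ⟨e1, e2, e3, e4, e5, e6⟩ := hA0 s
      simp only [f]
      generalize 4 / (1 + ∑ a, ∑ b, α s a b ^ 2) = r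
      simp only [Fin.sum_univ_three, e1, e2, e3, e4, e5, e6]
      ring) t ht
    rw [this, h0]
    have h2 : ((1 : Matrix (Fin 3) (Fin 3) ℝ)ᵀ * (1 : Matrix (Fin 3) (Fin 3) ℝ) :
        Matrix (Fin 3) (Fin 3) ℝ) k l = (1 : Matrix (Fin 3) (Fin 3) ℝ) k l := by simp
    rw [← h2, Matrix.mul_apply]; rfl
  have hdet : ∀ t ∈ Set.Ioo (-1) (L + 1), Matrix.det (Matrix.of (α t)) = 1 := by
    intro t ht
    have := hconst (fun s => Matrix.det (Matrix.of (α s))) (fun s hs => by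
      have d := hder' s hs
      simp only [Matrix.det_fin_three, Matrix.of_apply]
      have h := (((((((d 0 0).mul (d 1 1)).mul (d 2 2)).sub (((d 0 0).mul (d 1 2)).mul (d 2 1))).sub
        (((d 0 1).mul (d 1 0)).mul (d 2 2))).add (((d 0 1).mul (d 1 2)).mul (d 2 0))).add
        (((d 0 2).mul (d 1 0)).mul (d 2 1))).sub (((d 0 2).mul (d 1 1)).mul (d 2 0))
      refine h.congr_deriv ?_
      obtain ⟨e1, e2, e3, e4, e5, e6⟩ := hA0 s
      simp only [f, Pi.mul_apply]
      generalize 4 / (1 + ∑ a, ∑ b, α s a b ^ 2) = r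
      simp only [Fin.sum_univ_three, e1, e2, e3, e4, e5, e6]
      ring) t ht
    rw [this, h0]
    exact Matrix.det_one
  have hbump : (Metric.closedBall (L / 2) (L / 2 + 1 / 2)) ⊆ Set.Ioo (-1) (L + 1) := by
    intro x hx
    rw [Real.closedBall_eq_Icc] at hx
    exact ⟨by linarith [hx.1], by linarith [hx.2]⟩
  let β : ContDiffBump (L / 2) := ⟨L / 2 + 1 / 4, L / 2 + 1 / 2, by positivity, by linarith⟩
  refine ⟨fun t => Matrix.of fun i j => β t * α t i j, ?_, ?_⟩
  · intro i j
    rw [contDiff_iff_contDiffAt]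
    intro t
    by_cases ht : t ∈ tsupport β
    · have ht' : t ∈ Set.Ioo (-1) (L + 1) := by
        rw [β.tsupport_eq] at ht
        exact hbump ht
      refine (β.contDiffAt).mul ?_
      have := (hsm.contDiffAt (Icc_mem_nhds ht'.1 ht'.2))
      exact contDiffAt_pi.1 (contDiffAt_pi.1 this i) j
    · have h1 := notMem_tsupport_iff_eventuallyEq.1 ht
      refine (contDiffAt_const (c := (0 : ℝ))).congr_of_eventuallyEq ?_
      filter_upwards [h1] with s hs
      simp [hs]
  · intro t ht
    have ht' : t ∈ Set.Ioo (-1) (L + 1) := ⟨by linarith [ht.1], by linarith [ht.2]⟩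
    have hb1 : (β : ℝ → ℝ) =ᶠ[nhds t] 1 := by
      refine β.eventuallyEq_one_of_mem_ball ?_
      rw [Real.ball_eq_Ioo]
      exact ⟨by simp only [β]; linarith [ht.1], by simp only [β]; linarith [ht.2]⟩
    have hbt : β t = 1 := hb1.eq_of_nhds
    have hX : (Matrix.of fun i j => β t * α t i j) = Matrix.of (α t) := by
      ext i j; simp [hbt]
    have hnorm : ∑ a, ∑ b, α t a b ^ 2 = 3 := by
      have h := hgram t ht'
      have h1 := h 0 0
      have h2 := h 1 1
      have h3 := h 2 2
      simp [Fin.sum_univ_three] at h1 h2 h3 ⊢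
      linarith
    refine ⟨?_, ?_, ?_⟩
    · intro i k
      have := hder' t ht' i k
      simp only [hX]
      refine HasDerivAt.congr_of_eventuallyEq (f := fun s => α s i k) ?_ ?_
      · refine this.congr_deriv ?_
        simp only [f, hnorm]
        norm_num
      · filter_upwards [hb1] with s hs
        simp [hs]
    · simp only [hX]
      rw [mul_eq_one_comm]
      ext k l
      rw [Matrix.mul_apply]
      simpa using hgram t ht' k l
    · simp only [hX]
      exact hdet t ht'

def S4 (c : Fin 4 → ℝ → Fin 3 → ℝ) (z : ℝ × ℝ) : Fin 3 → ℝ := fun k =>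
  c 0 z.1 k + z.2 * c 1 z.1 k + z.2 ^ 2 * c 2 z.1 k + z.2 ^ 3 * c 3 z.1 k

def SM (c : Fin 4 → ℝ → Fin 3 → ℝ) : Prop := ∀ i k, ContDiff ℝ (⊤ : ℕ∞) (fun t => c i t k)

noncomputable def S4d0 (c : Fin 4 → ℝ → Fin 3 → ℝ) : Fin 4 → ℝ → Fin 3 → ℝ :=
  fun i t k => deriv (fun s => c i s k) t

def S4d1 (c : Fin 4 → ℝ → Fin 3 → ℝ) : Fin 4 → ℝ → Fin 3 → ℝ :=
  ![c 1, fun t k => 2 * c 2 t k, fun t k => 3 * c 3 t k, fun _ _ => 0]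

lemma SM.contDiff_apply {c : Fin 4 → ℝ → Fin 3 → ℝ} (h : SM c) (k : Fin 3) :
    ContDiff ℝ (⊤ : ℕ∞) (fun z => S4 c z k) := by
  have h' : ∀ i, ContDiff ℝ (⊤ : ℕ∞) (fun z : ℝ × ℝ => c i z.1 k) := fun i =>
    (h i k).comp contDiff_fst
  have h0 := h' 0
  have h1 := h' 1
  have h2 := h' 2
  have h3 := h' 3
  have hz : ContDiff ℝ (⊤ : ℕ∞) (fun z : ℝ × ℝ => z.2) := contDiff_snd
  exact ((h0.add (hz.mul h1)).add ((hz.pow 2).mul h2)).add ((hz.pow 3).mul h3)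

lemma SM.contDiff {c : Fin 4 → ℝ → Fin 3 → ℝ} (h : SM c) :
    ContDiff ℝ (⊤ : ℕ∞) (S4 c) := contDiff_pi.2 fun k => h.contDiff_apply k

lemma SM.d0 {c : Fin 4 → ℝ → Fin 3 → ℝ} (h : SM c) : SM (S4d0 c) := fun i k =>
  (contDiff_infty_iff_deriv.1 (h i k)).2

lemma SM.d1 {c : Fin 4 → ℝ → Fin 3 → ℝ} (h : SM c) : SM (S4d1 c) := by
  intro i k
  fin_cases i
  · exact h 1 k
  · exact contDiff_const.mul (h 2 k)
  · exact contDiff_const.mul (h 3 k)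
  · exact contDiff_const

lemma pdv_comp {f : ℝ × ℝ → Fin 3 → ℝ} {z : ℝ × ℝ} (hf : DifferentiableAt ℝ f z) (i : Fin 2)
    (k : Fin 3) : pdv i f z k = fderiv ℝ (fun y => f y k) z (E2 i) := by
  have := (hasFDerivAt_pi'.1 hf.hasFDerivAt k).fderiv
  rw [this]; rfl

lemma SM.pdv0 {c : Fin 4 → ℝ → Fin 3 → ℝ} (h : SM c) : pdv 0 (S4 c) = S4 (S4d0 c) := by
  ext z k
  rw [pdv_comp (h.contDiff.differentiable (by simp) z)]
  have hd := ((h.contDiff_apply k).differentiable (by simp) z).hasFDerivAt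
  have hp : HasDerivAt (fun s : ℝ => (s, z.2)) ((1 : ℝ), (0 : ℝ)) z.1 :=
    (hasDerivAt_id z.1).prodMk (hasDerivAt_const z.1 z.2)
  have h1 := HasFDerivAt.comp_hasDerivAt z.1 (f := fun s : ℝ => (s, z.2)) hd hp
  have hc : ∀ i, HasDerivAt (fun s => c i s k) (S4d0 c i z.1 k) z.1 := fun i =>
    ((h i k).differentiable (by simp) z.1).hasDerivAt
  have h2 := (((hc 0).add ((hc 1).const_mul z.2)).add ((hc 2).const_mul (z.2 ^ 2))).add
    ((hc 3).const_mul (z.2 ^ 3))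
  exact h1.unique h2

lemma SM.pdv1 {c : Fin 4 → ℝ → Fin 3 → ℝ} (h : SM c) : pdv 1 (S4 c) = S4 (S4d1 c) := by
  ext z k
  rw [pdv_comp (h.contDiff.differentiable (by simp) z)]
  have hd := ((h.contDiff_apply k).differentiable (by simp) z).hasFDerivAt
  have hp : HasDerivAt (fun s : ℝ => (z.1, s)) ((0 : ℝ), (1 : ℝ)) z.2 :=
    (hasDerivAt_const z.2 z.1).prodMk (hasDerivAt_id z.2)
  have h1 := HasFDerivAt.comp_hasDerivAt z.2 (f := fun s : ℝ => (z.1, s)) hd hp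
  have h2 := (((hasDerivAt_const z.2 (c 0 z.1 k)).add
    ((hasDerivAt_id z.2).mul_const (c 1 z.1 k))).add
    ((hasDerivAt_pow 2 z.2).mul_const (c 2 z.1 k))).add
    ((hasDerivAt_pow 3 z.2).mul_const (c 3 z.1 k))
  refine (h1.unique h2).trans ?_
  simp [S4, S4d1]
  ring

lemma bound_aux (L : ℝ) (G : ℝ × ℝ → ℝ) (hG : Continuous G) :
    ∃ C, 0 < C ∧ ∀ z ∈ Set.Ioo 0 L ×ˢ Set.Ioo (-1 : ℝ) 1, |G z| ≤ C := by
  obtain ⟨C, hC⟩ := ((isCompact_Icc (a := (0 : ℝ)) (b := L)).prod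
    (isCompact_Icc (a := (-1 : ℝ)) (b := 1))).exists_bound_of_continuousOn hG.continuousOn
  refine ⟨max C 1, by positivity, fun z hz => (hC z ?_).trans (le_max_left _ _)⟩
  exact ⟨⟨hz.1.1.le, hz.1.2.le⟩, ⟨hz.2.1.le, hz.2.2.le⟩⟩

lemma lin_aux (L : ℝ) (F : ℝ × ℝ → ℝ) (hF : ContDiff ℝ (⊤ : ℕ∞) F)  :
    ∃ C, 0 < C ∧ ∀ z ∈ Set.Ioo 0 L ×ˢ Set.Ioo (-1 : ℝ) 1, |F z - F (z.1, 0)| ≤ C * |z.2| := by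
  obtain ⟨K, hK⟩ := LocallyLipschitzOn.exists_lipschitzOnWith_of_compact
    ((isCompact_Icc (a := (0 : ℝ)) (b := L)).prod (isCompact_Icc (a := (-1 : ℝ)) (b := 1)))
    ((hF.of_le (by norm_cast) : ContDiff ℝ 1 F).locallyLipschitz.locallyLipschitzOn)
  refine ⟨K + 1, by positivity, fun z hz => ?_⟩
  have := hK.dist_le_mul z ⟨⟨hz.1.1.le, hz.1.2.le⟩, ⟨hz.2.1.le, hz.2.2.le⟩⟩ (z.1, 0)
    ⟨⟨hz.1.1.le, hz.1.2.le⟩, ⟨by norm_num, by norm_num⟩⟩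
  have hd : dist z (z.1, 0) = |z.2| := by
    rw [Prod.dist_eq]; simp
  rw [hd, Real.dist_eq] at this
  nlinarith [abs_nonneg z.2]

lemma cubic_aux (L : ℝ) (a b : Fin 4 → ℝ → Fin 3 → ℝ) (ha : SM a) (hb : SM b) :
    ∃ C, 0 < C ∧ ∀ z ∈ Set.Ioo 0 L ×ˢ Set.Ioo (-1 : ℝ) 1,
      |S4 a z ⬝ᵥ S4 b z - (a 0 z.1 ⬝ᵥ b 0 z.1 + z.2 * (a 0 z.1 ⬝ᵥ b 1 z.1 + a 1 z.1 ⬝ᵥ b 0 z.1)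
        + z.2 ^ 2 * (a 0 z.1 ⬝ᵥ b 2 z.1 + a 1 z.1 ⬝ᵥ b 1 z.1 + a 2 z.1 ⬝ᵥ b 0 z.1))|
        ≤ C * |z.2| ^ 3 := by
  have hc : ∀ i j, Continuous (fun z : ℝ × ℝ => a i z.1 ⬝ᵥ b j z.1) := fun i j => by
    have h1 : ∀ k, Continuous (fun z : ℝ × ℝ => a i z.1 k) := fun k =>
      (ha i k).continuous.comp continuous_fst
    have h2 : ∀ k, Continuous (fun z : ℝ × ℝ => b j z.1 k) := fun k =>
      (hb j k).continuous.comp continuous_fst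
    unfold dotProduct
    exact continuous_finsetSum _ fun k _ => (h1 k).mul (h2 k)
  obtain ⟨C, hC, h⟩ := bound_aux L (fun z : ℝ × ℝ =>
    (a 0 z.1 ⬝ᵥ b 3 z.1 + a 1 z.1 ⬝ᵥ b 2 z.1 + a 2 z.1 ⬝ᵥ b 1 z.1 + a 3 z.1 ⬝ᵥ b 0 z.1)
    + z.2 * (a 1 z.1 ⬝ᵥ b 3 z.1 + a 2 z.1 ⬝ᵥ b 2 z.1 + a 3 z.1 ⬝ᵥ b 1 z.1)
    + z.2 ^ 2 * (a 2 z.1 ⬝ᵥ b 3 z.1 + a 3 z.1 ⬝ᵥ b 2 z.1) + z.2 ^ 3 * (a 3 z.1 ⬝ᵥ b 3 z.1))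
    (by fun_prop)
  refine ⟨C, hC, fun z hz => ?_⟩
  rw [← abs_pow]
  refine le_trans (le_of_eq ?_) (mul_le_mul_of_nonneg_right (h z hz) (abs_nonneg _))
  rw [← abs_mul]
  congr 1
  simp only [S4, dotProduct, Fin.sum_univ_three]
  ring

lemma frob2_le {A : Matrix (Fin 2) (Fin 2) ℝ} {c : ℝ} (hc : 0 ≤ c) (h : ∀ i j, |A i j| ≤ c) :
    frob2 A ≤ 2 * c := by
  unfold frob2
  refine Real.sqrt_le_iff.2 ⟨by positivity, ?_⟩
  have h' : ∀ i j, A i j ^ 2 ≤ c ^ 2 := fun i j => sq_le_sq' (abs_le.1 (h i j)).1 (abs_le.1 (h i j)).2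
  simp only [Fin.sum_univ_two]
  linarith [h' 0 0, h' 0 1, h' 1 0, h' 1 1]

lemma quot_aux {x I q z K1 K2 M : ℝ} (hx : |x - I| ≤ K1 * z) (hq : |q - 1| ≤ K2 * z)
    (hI : |I| ≤ M) (hq4 : 1 / 4 ≤ q) :
    |(Real.sqrt q)⁻¹ * x - I| ≤ 2 * (K1 + M * K2) * z := by
  have hn : 1 / 2 ≤ Real.sqrt q := Real.le_sqrt_of_sq_le (by linarith)
  have hs : Real.sqrt q ^ 2 = q := Real.sq_sqrt (by linarith)
  set n := Real.sqrt q
  have h1 : |n - 1| ≤ K2 * z := by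
    refine le_trans ?_ hq
    rw [← hs, show n ^ 2 - 1 = (n - 1) * (n + 1) by ring, abs_mul]
    have : 1 ≤ |n + 1| := by rw [abs_of_pos] <;> linarith
    nlinarith [abs_nonneg (n - 1)]
  have h2 : n⁻¹ * x - I = n⁻¹ * ((x - I) - I * (n - 1)) := by
    field_simp
    ring
  have h3 : |n⁻¹| ≤ 2 := by
    rw [abs_inv, abs_of_pos (by linarith)]
    rw [inv_le_comm₀ (by linarith) (by norm_num)]
    linarith
  have h4 : |(x - I) - I * (n - 1)| ≤ (K1 + M * K2) * z := by
    refine (abs_sub _ _).trans ?_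
    rw [abs_mul]
    have := mul_le_mul hI h1 (abs_nonneg _) ((abs_nonneg _).trans hI)
    linarith
  rw [h2, abs_mul]
  have := mul_le_mul h3 h4 (abs_nonneg _) (by norm_num)
  linarith

noncomputable def Sd (i : Fin 2) : (Fin 4 → ℝ → Fin 3 → ℝ) → (Fin 4 → ℝ → Fin 3 → ℝ) :=
  if i = 0 then S4d0 else S4d1

lemma SM.d {c : Fin 4 → ℝ → Fin 3 → ℝ} (h : SM c) (i : Fin 2) : SM (Sd i c) := by
  fin_cases i
  · exact h.d0
  · exact h.d1

lemma SM.pdv {c : Fin 4 → ℝ → Fin 3 → ℝ} (h : SM c) (i : Fin 2) :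
    pdv i (S4 c) = S4 (Sd i c) := by
  fin_cases i
  · exact h.pdv0
  · exact h.pdv1

lemma cross3_contDiff {a b : Fin 4 → ℝ → Fin 3 → ℝ} (ha : SM a) (hb : SM b) (k : Fin 3) :
    ContDiff ℝ (⊤ : ℕ∞) (fun z => cross3 (S4 a z) (S4 b z) k) := by
  have h1 := ha.contDiff_apply
  have h2 := hb.contDiff_apply
  fin_cases k
  · exact ((h1 1).mul (h2 2)).sub ((h1 2).mul (h2 1))
  · exact ((h1 2).mul (h2 0)).sub ((h1 0).mul (h2 2))
  · exact ((h1 0).mul (h2 1)).sub ((h1 1).mul (h2 0))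

lemma S4_zero (c : Fin 4 → ℝ → Fin 3 → ℝ) (s : ℝ) : S4 c (s, 0) = c 0 s := by
  ext k; simp [S4]

/-- Sufficient pointwise conditions along the midline. -/
lemma main_aux (L : ℝ) (κ : ℝ → ℝ) (II0 : ℝ → Matrix (Fin 2) (Fin 2) ℝ)
    (hII0 : ∀ i j : Fin 2, ContDiff ℝ (⊤ : ℕ∞) fun t => II0 t i j)
    (c : Fin 4 → ℝ → Fin 3 → ℝ) (hc : SM c)
    (h1 : ∀ s ∈ Set.Ioo 0 L, ∀ i j : Fin 2, Sd i c 0 s ⬝ᵥ Sd j c 0 s =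
      (!![1, 0; 0, 1] : Matrix (Fin 2) (Fin 2) ℝ) i j)
    (h2 : ∀ s ∈ Set.Ioo 0 L, ∀ i j : Fin 2, Sd i c 0 s ⬝ᵥ Sd j c 1 s + Sd i c 1 s ⬝ᵥ Sd j c 0 s =
      (!![-2 * κ s, 0; 0, 0] : Matrix (Fin 2) (Fin 2) ℝ) i j)
    (h3 : ∀ s ∈ Set.Ioo 0 L, ∀ i j : Fin 2, Sd i c 0 s ⬝ᵥ Sd j c 2 s + Sd i c 1 s ⬝ᵥ Sd j c 1 s
      + Sd i c 2 s ⬝ᵥ Sd j c 0 s =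
      (!![κ s ^ 2 - (II0 s).det, 0; 0, 0] : Matrix (Fin 2) (Fin 2) ℝ) i j)
    (h4 : ∀ s ∈ Set.Ioo 0 L, ∀ i j : Fin 2,
      Sd i (Sd j c) 0 s ⬝ᵥ cross3 (Sd 0 c 0 s) (Sd 1 c 0 s) = II0 s i j) :
    ∃ (w C : ℝ) (Φ : ℝ × ℝ → Fin 3 → ℝ), 0 < w ∧ 0 < C ∧
      ContDiffOn ℝ (⊤ : ℕ∞) Φ (Set.Ioo 0 L ×ˢ Set.Ioo (-(w/2)) (w/2)) ∧
      (∀ z ∈ Set.Ioo 0 L ×ˢ Set.Ioo (-(w/2)) (w/2),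
        cross3 (pdv 0 Φ z) (pdv 1 Φ z) ≠ 0) ∧
      (∀ z ∈ Set.Ioo 0 L ×ˢ Set.Ioo (-(w/2)) (w/2),
        frob2 (firstFF Φ z -
          !![(1 - κ z.1 * z.2) ^ 2 - (II0 z.1).det * z.2 ^ 2, 0; 0, 1]) ≤
          C * |z.2| ^ 3) ∧
      (∀ z ∈ Set.Ioo 0 L ×ˢ Set.Ioo (-(w/2)) (w/2),
        frob2 (secondFF Φ z - II0 z.1) ≤ C * |z.2|) := by
  let cr : ℝ × ℝ → Fin 3 → ℝ := fun z => cross3 (S4 (Sd 0 c) z) (S4 (Sd 1 c) z)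
  have hcr : ∀ k, ContDiff ℝ (⊤ : ℕ∞) (fun z => cr z k) := fun k =>
    cross3_contDiff (hc.d 0) (hc.d 1) k
  let q : ℝ × ℝ → ℝ := fun z => ∑ k, cr z k ^ 2
  have hq : ContDiff ℝ (⊤ : ℕ∞) q := ContDiff.sum fun k _ => (hcr k).pow 2
  let F : Fin 2 → Fin 2 → ℝ × ℝ → ℝ := fun i j z => S4 (Sd i (Sd j c)) z ⬝ᵥ cr z
  have hF : ∀ i j, ContDiff ℝ (⊤ : ℕ∞) (F i j) := fun i j =>
    ContDiff.sum fun k _ => (((hc.d j).d i).contDiff_apply k).mul (hcr k)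
  have hq0 : ∀ s ∈ Set.Ioo 0 L, q (s, 0) = 1 := by
    intro s hs
    have e1 := h1 s hs 0 0
    have e2 := h1 s hs 0 1
    have e3 := h1 s hs 1 1
    simp only [q, cr, S4_zero]
    generalize Sd 0 c 0 s = u at *
    generalize Sd 1 c 0 s = v at *
    simp [dotProduct, Fin.sum_univ_three] at e1 e2 e3
    simp [cross3, Fin.sum_univ_three]
    linear_combination (v 0 * v 0 + v 1 * v 1 + v 2 * v 2) * e1 + e3
      - (u 0 * v 0 + u 1 * v 1 + u 2 * v 2) * e2
  have hF0 : ∀ s ∈ Set.Ioo 0 L, ∀ i j, F i j (s, 0) = II0 s i j := by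
    intro s hs i j
    simp only [F, cr, S4_zero]
    exact h4 s hs i j
  obtain ⟨Kq, hKq, hbq⟩ := lin_aux L q hq
  choose KF hKF hbF using fun i j => lin_aux L (F i j) (hF i j)
  choose KI hKI hbI using fun i j => bound_aux L (fun z => II0 z.1 i j)
    ((hII0 i j).continuous.comp continuous_fst)
  choose K1 hK1 hb1 using fun i j => cubic_aux L (Sd i c) (Sd j c) (hc.d i) (hc.d j)
  let w : ℝ := min 1 (1 / Kq)
  have hw : 0 < w := by positivity
  have hw1 : w ≤ 1 := min_le_left _ _
  have hw2 : w * Kq ≤ 1 := by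
    have : w ≤ 1 / Kq := min_le_right _ _
    rwa [le_div_iff₀ hKq] at this
  have hdom : ∀ z ∈ Set.Ioo 0 L ×ˢ Set.Ioo (-(w/2)) (w/2), z ∈ Set.Ioo 0 L ×ˢ Set.Ioo (-1 : ℝ) 1 := by
    intro z hz
    exact ⟨hz.1, by linarith [hz.2.1], by linarith [hz.2.2]⟩
  have hbq' : ∀ z ∈ Set.Ioo 0 L ×ˢ Set.Ioo (-(w/2)) (w/2), |q z - 1| ≤ Kq * |z.2| := by
    intro z hz
    have := hbq z (hdom z hz)
    rwa [hq0 z.1 hz.1] at this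
  have hq4 : ∀ z ∈ Set.Ioo 0 L ×ˢ Set.Ioo (-(w/2)) (w/2), 1 / 4 ≤ q z := by
    intro z hz
    have h := hbq' z hz
    have hz2 : |z.2| < w / 2 := abs_lt.2 hz.2
    have := (abs_le.1 h).1
    nlinarith
  have hcrz : ∀ z, cross3 (pdv 0 (S4 c) z) (pdv 1 (S4 c) z) = cr z := by
    intro z; rw [hc.pdv 0, hc.pdv 1]
  let C1 : ℝ := ∑ i, ∑ j, K1 i j
  let C2 : ℝ := ∑ i, ∑ j, 2 * (KF i j + KI i j * Kq)
  have hC1 : ∀ i j, K1 i j ≤ C1 := by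
    intro i j
    have := fun i j => (hK1 i j).le
    exact (Finset.single_le_sum (f := fun j => K1 i j) (fun b _ => this i b)
          (Finset.mem_univ j)).trans
        (Finset.single_le_sum (f := fun a => ∑ b, K1 a b)
          (fun a _ => Finset.sum_nonneg fun b _ => this a b) (Finset.mem_univ i))
  have hC2 : ∀ i j, 2 * (KF i j + KI i j * Kq) ≤ C2 := by
    intro i j
    have : ∀ i j, 0 ≤ 2 * (KF i j + KI i j * Kq) := fun i j => by
      have := hKF i j
      have := hKI i j
      positivity
    exact (Finset.single_le_sum (f := fun j => 2 * (KF i j + KI i j * Kq)) (fun b _ => this i b)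
          (Finset.mem_univ j)).trans
        (Finset.single_le_sum (f := fun a => ∑ b, 2 * (KF a b + KI a b * Kq))
          (fun a _ => Finset.sum_nonneg fun b _ => this a b) (Finset.mem_univ i))
  have hC1p : 0 < C1 := (hK1 0 0).trans_le (hC1 0 0)
  have hC2p : 0 < C2 := lt_of_lt_of_le
    (by have := hKF 0 0; have := hKI 0 0; positivity) (hC2 0 0)
  refine ⟨w, 2 * (C1 + C2), S4 c, hw, by positivity, hc.contDiff.contDiffOn, ?_, ?_, ?_⟩
  · intro z hz h0
    have := hq4 z hz
    rw [hcrz] at h0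
    simp only [q, h0] at this
    norm_num at this
  · intro z hz
    rw [mul_assoc]
    refine frob2_le (by positivity) fun i j => ?_
    have h := hb1 i j z (hdom z hz)
    have hle : K1 i j * |z.2| ^ 3 ≤ (C1 + C2) * |z.2| ^ 3 :=
      mul_le_mul_of_nonneg_right (by linarith [hC1 i j]) (by positivity)
    refine le_trans (le_of_eq ?_) (h.trans hle)
    congr 1
    rw [h1 z.1 hz.1, h2 z.1 hz.1, h3 z.1 hz.1, Matrix.sub_apply, firstFF, Matrix.of_apply,
      hc.pdv i, hc.pdv j]
    congr 1
    fin_cases i <;> fin_cases j <;> simp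
    ring
  · intro z hz
    rw [mul_assoc]
    refine frob2_le (by positivity) fun i j => ?_
    have hx := hbF i j z (hdom z hz)
    rw [hF0 z.1 hz.1] at hx
    have h := quot_aux hx (hbq' z hz) (hbI i j z (hdom z hz)) (hq4 z hz)
    have hle : 2 * (KF i j + KI i j * Kq) * |z.2| ≤ (C1 + C2) * |z.2| :=
      mul_le_mul_of_nonneg_right (by linarith [hC2 i j]) (by positivity)
    refine le_trans (le_of_eq ?_) (h.trans hle)
    congr 1
    rw [Matrix.sub_apply, secondFF, Matrix.of_apply, nuv, hcrz, dotProduct_smul, hc.pdv j,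
      (hc.d j).pdv i]
    rfl

/-- given a smooth geodesic curvature `κ` and a smooth symmetric
reference second fundamental form `II⁰` along the midline, there is, for some
small width `w`, a smooth immersion `Φ` of `(0,L)×(−w/2,w/2)` into ℝ³ whose first
fundamental form is `diag((1−κz₂)² − det(II⁰)z₂², 1) + O(|z₂|³)` and whose second
fundamental form is `II⁰(z₁) + O(|z₂|)`. -/
theorem stmt0 (L : ℝ) (hL : 0 < L) (κ : ℝ → ℝ) (hκ : ContDiff ℝ (⊤ : ℕ∞) κ)
    (II0 : ℝ → Matrix (Fin 2) (Fin 2) ℝ)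
    (hII0 : ∀ i j : Fin 2, ContDiff ℝ (⊤ : ℕ∞) fun t => II0 t i j)
    (hsymm : ∀ t : ℝ, (II0 t).IsSymm) :
    ∃ (w C : ℝ) (Φ : ℝ × ℝ → Fin 3 → ℝ), 0 < w ∧ 0 < C ∧
      ContDiffOn ℝ (⊤ : ℕ∞) Φ (Set.Ioo 0 L ×ˢ Set.Ioo (-(w/2)) (w/2)) ∧
      (∀ z ∈ Set.Ioo 0 L ×ˢ Set.Ioo (-(w/2)) (w/2),
        cross3 (pdv 0 Φ z) (pdv 1 Φ z) ≠ 0) ∧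
      (∀ z ∈ Set.Ioo 0 L ×ˢ Set.Ioo (-(w/2)) (w/2),
        frob2 (firstFF Φ z -
          !![(1 - κ z.1 * z.2) ^ 2 - (II0 z.1).det * z.2 ^ 2, 0; 0, 1]) ≤
          C * |z.2| ^ 3) ∧
      (∀ z ∈ Set.Ioo 0 L ×ˢ Set.Ioo (-(w/2)) (w/2),
        frob2 (secondFF Φ z - II0 z.1) ≤ C * |z.2|) := by
  have hsy : ∀ t, II0 t 1 0 = II0 t 0 1 := fun t => (hsymm t).apply 0 1
  obtain ⟨X, hX, hXs⟩ := frame_exists_aux L hL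
    (fun t => ![![0, κ t, II0 t 0 0], ![-κ t, 0, II0 t 0 1], ![-II0 t 0 0, -II0 t 0 1, 0]])
    (by
      intro i j
      fin_cases i <;> fin_cases j
      · exact contDiff_const
      · exact hκ
      · exact hII0 0 0
      · exact hκ.neg
      · exact contDiff_const
      · exact hII0 0 1
      · exact (hII0 0 0).neg
      · exact (hII0 0 1).neg
      · exact contDiff_const)
    (by
      intro t i j
      fin_cases i <;> fin_cases j <;> simp)
  let g : ℝ → Fin 3 → ℝ := fun t k => ∫ s in (0 : ℝ)..t, X s 0 k
  have hg : ∀ t k, HasDerivAt (fun s => g s k) (X t 0 k) t := fun t k =>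
    intervalIntegral.integral_hasDerivAt_right
      ((hX 0 k).continuous.intervalIntegrable _ _)
      ((hX 0 k).continuous.stronglyMeasurableAtFilter _ _)
      (hX 0 k).continuous.continuousAt
  have hgd : ∀ k, deriv (fun s => g s k) = fun s => X s 0 k := fun k =>
    funext fun t => (hg t k).deriv
  have hgs : ∀ k, ContDiff ℝ (⊤ : ℕ∞) (fun t => g t k) := fun k => by
    rw [contDiff_infty_iff_deriv]
    refine ⟨fun t => (hg t k).differentiableAt, ?_⟩
    rw [hgd]
    exact hX 0 k
  let P : ℝ → Fin 3 → ℝ := fun t k => II0 t 1 1 / 2 * X t 2 k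
  let Q : ℝ → Fin 3 → ℝ := fun t k =>
    -(II0 t 0 1 * II0 t 1 1 / 6) * X t 0 k - (II0 t 1 1 ^ 2 / 6) * X t 1 k
  let c : Fin 4 → ℝ → Fin 3 → ℝ := ![g, fun t => X t 1, P, Q]
  have hc : SM c := by
    intro i k
    fin_cases i
    · exact hgs k
    · exact hX 1 k
    · exact ((hII0 1 1).div_const 2).mul (hX 2 k)
    · exact ((((hII0 0 1).mul (hII0 1 1)).div_const 6).neg.mul (hX 0 k)).sub
        ((((hII0 1 1).pow 2).div_const 6).mul (hX 1 k))
  have key : ∀ s ∈ Set.Ioo 0 L, ∃ c' : ℝ, 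
      (Sd 0 c 0 s = fun k => X s 0 k) ∧
      (Sd 0 c 1 s = fun k => - κ s * X s 0 k + II0 s 0 1 * X s 2 k) ∧
      (Sd 0 c 2 s = fun k => c' / 2 * X s 2 k +
        II0 s 1 1 / 2 * (- II0 s 0 0 * X s 0 k - II0 s 0 1 * X s 1 k)) ∧
      (Sd 1 c 0 s = fun k => X s 1 k) ∧
      (Sd 1 c 1 s = fun k => II0 s 1 1 * X s 2 k) ∧
      (Sd 1 c 2 s = fun k => 
        -(II0 s 0 1 * II0 s 1 1 / 2) * X s 0 k - (II0 s 1 1 ^ 2 / 2) * X s 1 k) ∧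
      (Sd 0 (Sd 0 c) 0 s = fun k => κ s * X s 1 k + II0 s 0 0 * X s 2 k) ∧
      (Sd 1 (Sd 0 c) 0 s = fun k => - κ s * X s 0 k + II0 s 0 1 * X s 2 k) ∧
      (Sd 0 (Sd 1 c) 0 s = fun k => - κ s * X s 0 k + II0 s 0 1 * X s 2 k) ∧
      (Sd 1 (Sd 1 c) 0 s = fun k => II0 s 1 1 * X s 2 k) := by
    intro s hs
    obtain ⟨hd, -, -⟩ := hXs s hs
    have d0 : ∀ k, deriv (fun s => X s 0 k) s = κ s * X s 1 k + II0 s 0 0 * X s 2 k := fun k => by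
      rw [(hd 0 k).deriv]; simp [Fin.sum_univ_three]
    have d1 : ∀ k, deriv (fun s => X s 1 k) s = - κ s * X s 0 k + II0 s 0 1 * X s 2 k := fun k => by
      rw [(hd 1 k).deriv]; simp [Fin.sum_univ_three]
    have d2 : ∀ k, HasDerivAt (fun s => X s 2 k)
        (- II0 s 0 0 * X s 0 k - II0 s 0 1 * X s 1 k) s := fun k => by
      refine (hd 2 k).congr_deriv ?_
      simp [Fin.sum_univ_three]; ring
    have dP : ∀ k, deriv (fun s => P s k) s = deriv (fun t => II0 t 1 1) s / 2 * X s 2 k +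
        II0 s 1 1 / 2 * (- II0 s 0 0 * X s 0 k - II0 s 0 1 * X s 1 k) := fun k =>
      ((((hII0 1 1).differentiable (by simp) s).hasDerivAt.div_const 2).mul (d2 k)).deriv
    have hSd0 : Sd 0 = S4d0 := rfl
    have hSd1 : Sd 1 = S4d1 := rfl
    refine ⟨deriv (fun t => II0 t 1 1) s, ?_, ?_, ?_, ?_, ?_, ?_, ?_, ?_, ?_, ?_⟩
    · ext k; exact congrFun (hgd k) s
    · ext k; exact d1 k
    · ext k; exact dP k
    · rfl
    · ext k; simp only [hSd1, S4d1, c, P]; simp; ring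
    · ext k; simp only [hSd1, S4d1, c, Q]; simp; ring
    · ext k
      have : (fun t => Sd 0 c 0 t k) = fun t => X t 0 k := hgd k
      refine Eq.trans ?_ (d0 k)
      rw [← this]; rfl
    · ext k; exact d1 k
    · ext k; exact d1 k
    · ext k; simp only [hSd1, S4d1, c, P]; simp; ring
  have key2 : ∀ s ∈ Set.Ioo 0 L, ∀ i j, X s i ⬝ᵥ X s j = (1 : Matrix (Fin 3) (Fin 3) ℝ) i j := by
    intro s hs i j
    rw [← (hXs s hs).2.1]; rfl
  refine main_aux L κ II0 hII0 c hc ?_ ?_ ?_ ?_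
  all_goals
    intro s hs i j
    obtain ⟨c', k1, k2, k3, k4, k5, k6, k7, k8, k9, k10⟩ := key s hs
    have o := key2 s hs
    have o00 := o 0 0
    have o01 := o 0 1
    have o02 := o 0 2
    have o11 := o 1 1
    have o12 := o 1 2
    have o22 := o 2 2
    have hdet := (hXs s hs).2.2
    have hs10 := hsy s
    rw [Matrix.det_fin_three] at hdet
    simp [dotProduct, Fin.sum_univ_three] at o00 o01 o02 o11 o12 o22
  · fin_cases i <;> fin_cases j <;>
      simp [k1, k4, dotProduct, Fin.sum_univ_three]
    · linear_combination o00
    · linear_combination o01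
    · linear_combination o01
    · linear_combination o11
  · fin_cases i <;> fin_cases j <;>
      simp only [k1, k2, k4, k5, dotProduct, Fin.sum_univ_three, Fin.zero_eta, Fin.mk_one] <;> simp
    · linear_combination (-2 * κ s) * o00 + 2 * II0 s 0 1 * o02
    · linear_combination II0 s 1 1 * o02 - κ s * o01 + II0 s 0 1 * o12
    · linear_combination II0 s 1 1 * o02 - κ s * o01 + II0 s 0 1 * o12
    · linear_combination 2 * II0 s 1 1 * o12
  · fin_cases i <;> fin_cases j <;>
      simp only [k1, k2, k3, k4, k5, k6, dotProduct, Fin.sum_univ_three, Fin.zero_eta, Fin.mk_one,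
        Matrix.det_fin_two, hs10] <;> simp
    · linear_combination c' * o02 + II0 s 1 1 * (- II0 s 0 0 * o00 - II0 s 0 1 * o01)
        + κ s ^ 2 * o00 - 2 * κ s * II0 s 0 1 * o02 + II0 s 0 1 ^ 2 * o22
    · linear_combination -(II0 s 0 1 * II0 s 1 1 / 2) * o00 - (II0 s 1 1 ^ 2 / 2) * o01
        - κ s * II0 s 1 1 * o02 + II0 s 0 1 * II0 s 1 1 * o22
        + c' / 2 * o12 + II0 s 1 1 / 2 * (- II0 s 0 0 * o01 - II0 s 0 1 * o11)
    · linear_combination -(II0 s 0 1 * II0 s 1 1 / 2) * o00 - (II0 s 1 1 ^ 2 / 2) * o01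
        - κ s * II0 s 1 1 * o02 + II0 s 0 1 * II0 s 1 1 * o22
        + c' / 2 * o12 + II0 s 1 1 / 2 * (- II0 s 0 0 * o01 - II0 s 0 1 * o11)
    · linear_combination 2 * (-(II0 s 0 1 * II0 s 1 1 / 2) * o01 - (II0 s 1 1 ^ 2 / 2) * o11)
        + II0 s 1 1 ^ 2 * o22
  · fin_cases i <;> fin_cases j <;>
      simp only [k1, k4, k7, k8, k9, k10, cross3, dotProduct, Fin.sum_univ_three, Fin.zero_eta,
        Fin.mk_one, hs10] <;> simp
    · linear_combination II0 s 0 0 * hdet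
    · linear_combination II0 s 0 1 * hdet
    · linear_combination II0 s 0 1 * hdet
    · linear_combination II0 s 1 1 * hdet
end

section
/- Let L > 0, let κ : ℝ → ℝ be smooth, and let A : ℝ → ℝ^{2×2} be a smooth map such that A(x₁) is symmetric, det A(x₁) = 0 and A₁₁(x₁) ≠ 0 for every x₁ ∈ [0,L]. Then there exist w > 0 and a smooth map v : (0,L)×(−w/2,w/2) → ℝ³ such that v is an isometric immersion of the flat ribbon metric, i.e. ∂₁v·∂₁v = (1−κ(z₁)z₂)², ∂₁v·∂₂v = 0, ∂₂v·∂₂v = 1 everywhere, and the second fundamental form of v along the midline equals the prescribed field: II_v(z₁,0) = A(z₁) for every z₁ ∈ (0,L). -/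
open Matrix

open Set Filter Topology

lemma rb_prim (f : ℝ → ℝ) (hf : ContDiff ℝ (⊤ : ℕ∞) f) :
    ∃ F : ℝ → ℝ, ContDiff ℝ (⊤ : ℕ∞) F ∧ ∀ t, HasDerivAt F (f t) t := by
  have h : ∀ t, HasDerivAt (fun u => ∫ s in (0:ℝ)..u, f s) (f t) t := fun t =>
    intervalIntegral.integral_hasDerivAt_right (hf.continuous.intervalIntegrable _ _)
      (hf.continuous.stronglyMeasurableAtFilter _ _) hf.continuous.continuousAt
  refine ⟨_, ?_, h⟩
  rw [contDiff_infty_iff_deriv]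
  refine ⟨fun t => (h t).differentiableAt, ?_⟩
  have : deriv (fun u => ∫ s in (0:ℝ)..u, f s) = f := funext fun t => (h t).deriv
  rw [this]; exact hf

lemma rb_primOn (T : ℝ) (hT : 0 < T) (f : ℝ → ℝ) (hf : ContDiffOn ℝ (⊤ : ℕ∞) f (Ioo (-T) T)) :
    ∃ F : ℝ → ℝ, ContDiffOn ℝ (⊤ : ℕ∞) F (Ioo (-T) T) ∧
      ∀ t ∈ Ioo (-T) T, HasDerivAt F (f t) t := by
  have h : ∀ t ∈ Ioo (-T) T, HasDerivAt (fun u => ∫ s in (0:ℝ)..u, f s) (f t) t := by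
    intro t ht
    refine intervalIntegral.integral_hasDerivAt_right ?_ ?_ ?_
    · apply ContinuousOn.intervalIntegrable
      apply hf.continuousOn.mono
      apply (ordConnected_Ioo).uIcc_subset ⟨by linarith, hT⟩ ht
    · exact hf.continuousOn.stronglyMeasurableAtFilter isOpen_Ioo t ht
    · exact hf.continuousOn.continuousAt (isOpen_Ioo.mem_nhds ht)
  refine ⟨_, ?_, h⟩
  rw [contDiffOn_infty_iff_deriv_of_isOpen isOpen_Ioo]
  refine ⟨fun t ht => (h t ht).differentiableAt.differentiableWithinAt, ?_⟩
  exact hf.congr fun t ht => (h t ht).deriv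

lemma rb_scalar (T : ℝ) (hT : 0 < T) (a b : ℝ → ℝ) (ha : ContDiff ℝ (⊤ : ℕ∞) a)
    (hb : ContDiff ℝ (⊤ : ℕ∞) b) (x0 y0 n0 : ℝ) (h0 : x0 ^ 2 + y0 ^ 2 + n0 ^ 2 = 1) :
    ∃ x y n : ℝ → ℝ, x 0 = x0 ∧ y 0 = y0 ∧ n 0 = n0 ∧ ∀ t ∈ Ioo (-T) T,
      HasDerivAt x (a t * n t) t ∧ HasDerivAt y (b t * n t) t ∧
      HasDerivAt n (-a t * x t - b t * y t) t := by
  let χ : ContDiffBump (0 : ℝ × ℝ × ℝ) := ⟨1, 2, one_pos, one_lt_two⟩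
  have hχ1 : ContDiff ℝ 1 χ := χ.contDiff
  let g1 : ℝ × ℝ × ℝ → ℝ × ℝ × ℝ := fun u => χ u • (u.2.2, 0, - u.1)
  let g2 : ℝ × ℝ × ℝ → ℝ × ℝ × ℝ := fun u => χ u • (0, u.2.2, - u.2.1)
  have hg1 : ContDiff ℝ 1 g1 := hχ1.smul (by fun_prop)
  have hg2 : ContDiff ℝ 1 g2 := hχ1.smul (by fun_prop)
  have hc1 : HasCompactSupport g1 := χ.hasCompactSupport.smul_right
  have hc2 : HasCompactSupport g2 := χ.hasCompactSupport.smul_right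
  obtain ⟨K1, hK1⟩ := hg1.lipschitzWith_of_hasCompactSupport hc1 one_ne_zero
  obtain ⟨K2, hK2⟩ := hg2.lipschitzWith_of_hasCompactSupport hc2 one_ne_zero
  obtain ⟨B1, hB1⟩ := hc1.exists_bound_of_continuous hg1.continuous
  obtain ⟨B2, hB2⟩ := hc2.exists_bound_of_continuous hg2.continuous
  obtain ⟨Ma, hMa⟩ := (isCompact_Icc (a := -T) (b := T)).exists_bound_of_continuousOn
    ha.continuous.continuousOn
  obtain ⟨Mb, hMb⟩ := (isCompact_Icc (a := -T) (b := T)).exists_bound_of_continuousOn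
    hb.continuous.continuousOn
  have h0m : (0:ℝ) ∈ Icc (-T) T := ⟨by linarith, hT.le⟩
  have hMa0 : 0 ≤ Ma := (norm_nonneg _).trans (hMa 0 h0m)
  have hMb0 : 0 ≤ Mb := (norm_nonneg _).trans (hMb 0 h0m)
  have hB10 : 0 ≤ B1 := (norm_nonneg _).trans (hB1 0)
  have hB20 : 0 ≤ B2 := (norm_nonneg _).trans (hB2 0)
  lift Ma to NNReal using hMa0
  lift Mb to NNReal using hMb0
  lift B1 to NNReal using hB10
  lift B2 to NNReal using hB20
  let f : ℝ → ℝ × ℝ × ℝ → ℝ × ℝ × ℝ := fun t u => a t • g1 u + b t • g2 u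
  have hPL : IsPicardLindelof f (tmin := -T) (tmax := T) ⟨0, h0m⟩ (x0, y0, n0)
      ((Ma * B1 + Mb * B2) * T.toNNReal) 0 (Ma * B1 + Mb * B2) (Ma * K1 + Mb * K2) := by
    refine ⟨?_, ?_, ?_, ?_⟩
    · intro t ht
      apply LipschitzWith.lipschitzOnWith
      apply LipschitzWith.of_dist_le_mul
      intro u v
      have e1 := hK1.dist_le_mul u v
      have e2 := hK2.dist_le_mul u v
      have m1 := hMa t ht
      have m2 := hMb t ht
      calc dist (f t u) (f t v) ≤ dist (a t • g1 u) (a t • g1 v) + dist (b t • g2 u) (b t • g2 v) :=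
            dist_add_add_le _ _ _ _
        _ = ‖a t‖ * dist (g1 u) (g1 v) + ‖b t‖ * dist (g2 u) (g2 v) := by
            rw [dist_smul₀, dist_smul₀]
        _ ≤ Ma * (K1 * dist u v) + Mb * (K2 * dist u v) := by gcongr
        _ = _ := by push_cast; ring
    · intro u _
      exact ((ha.continuous.smul continuous_const).add
        (hb.continuous.smul continuous_const)).continuousOn
    · intro t ht u _
      have m1 := hMa t ht
      have m2 := hMb t ht
      have e1 := hB1 u
      have e2 := hB2 u
      calc ‖f t u‖ ≤ ‖a t‖ * ‖g1 u‖ + ‖b t‖ * ‖g2 u‖ := by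
            refine (norm_add_le _ _).trans ?_
            rw [norm_smul (a t), norm_smul (b t)]
        _ ≤ Ma * B1 + Mb * B2 := by gcongr
        _ = _ := by push_cast; ring
    · simp [hT.le]
  obtain ⟨α, hα0, hα⟩ := hPL.exists_eq_forall_mem_Icc_hasDerivWithinAt₀
  have hd : ∀ t ∈ Icc (-T) T,
      HasDerivWithinAt (fun t => (α t).1) (χ (α t) * (a t * (α t).2.2)) (Icc (-T) T) t ∧
      HasDerivWithinAt (fun t => (α t).2.1) (χ (α t) * (b t * (α t).2.2)) (Icc (-T) T) t ∧
      HasDerivWithinAt (fun t => (α t).2.2)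
        (χ (α t) * (-a t * (α t).1 - b t * (α t).2.1)) (Icc (-T) T) t := by
    intro t ht
    have h := (hα t ht).hasFDerivWithinAt
    refine ⟨?_, ?_, ?_⟩
    · convert! h.fst.hasDerivWithinAt using 1
      simp [f, g1, g2]; ring
    · convert! h.snd.fst.hasDerivWithinAt using 1
      simp [f, g1, g2]; ring
    · convert! h.snd.snd.hasDerivWithinAt using 1
      simp [f, g1, g2]; ring
  have hα0' : α 0 = (x0, y0, n0) := hα0
  have hcons : ∀ t ∈ Icc (-T) T, (α t).1 ^ 2 + (α t).2.1 ^ 2 + (α t).2.2 ^ 2 = 1 := by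
    have key : ∀ t ∈ Icc (-T) T, HasDerivWithinAt
        (fun t => (α t).1 ^ 2 + (α t).2.1 ^ 2 + (α t).2.2 ^ 2) 0 (Icc (-T) T) t := by
      intro t ht
      obtain ⟨h1, h2, h3⟩ := hd t ht
      convert! ((h1.pow 2).add (h2.pow 2)).add (h3.pow 2) using 1
      simp; ring
    intro t ht
    have := (convex_Icc (-T) T).is_const_of_fderivWithin_eq_zero (𝕜 := ℝ)
      (fun s hs => (key s hs).differentiableWithinAt)
      (fun s hs => by
        have := (key s hs).hasFDerivWithinAt.fderivWithin ((uniqueDiffOn_Icc (by linarith)) s hs)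
        rw [this]; ext; simp) ht h0m
    simp only [hα0'] at this
    rw [this]; exact h0
  have hχ : ∀ t ∈ Icc (-T) T, χ (α t) = 1 := by
    intro t ht
    apply χ.one_of_mem_closedBall
    have := hcons t ht
    simp only [mem_closedBall_zero_iff, Prod.norm_def, sup_le_iff, Real.norm_eq_abs, χ]
    refine ⟨?_, ?_, ?_⟩ <;> rw [← sq_le_one_iff_abs_le_one] <;> nlinarith [sq_nonneg (α t).1,
      sq_nonneg (α t).2.1, sq_nonneg (α t).2.2]
  refine ⟨fun t => (α t).1, fun t => (α t).2.1, fun t => (α t).2.2, by simp [hα0'], by simp [hα0'],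
    by simp [hα0'], fun t ht => ?_⟩
  have ht' := Ioo_subset_Icc_self ht
  have hn : Icc (-T) T ∈ 𝓝 t := Icc_mem_nhds ht.1 ht.2
  obtain ⟨h1, h2, h3⟩ := hd t ht'
  rw [hχ t ht', one_mul] at h1 h2 h3
  exact ⟨h1.hasDerivAt hn, h2.hasDerivAt hn, h3.hasDerivAt hn⟩

lemma rb_smooth (T : ℝ) (a b : ℝ → ℝ) (ha : ContDiff ℝ (⊤ : ℕ∞) a)
    (hb : ContDiff ℝ (⊤ : ℕ∞) b) (x y n : ℝ → ℝ)
    (h : ∀ t ∈ Ioo (-T) T,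
      HasDerivAt x (a t * n t) t ∧ HasDerivAt y (b t * n t) t ∧
      HasDerivAt n (-a t * x t - b t * y t) t) :
    ContDiffOn ℝ (⊤ : ℕ∞) x (Ioo (-T) T) ∧ ContDiffOn ℝ (⊤ : ℕ∞) y (Ioo (-T) T) ∧
    ContDiffOn ℝ (⊤ : ℕ∞) n (Ioo (-T) T) := by
  have key : ∀ k : ℕ, ContDiffOn ℝ k x (Ioo (-T) T) ∧ ContDiffOn ℝ k y (Ioo (-T) T) ∧
      ContDiffOn ℝ k n (Ioo (-T) T) := by
    intro k
    induction k with
    | zero =>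
      simp only [CharP.cast_eq_zero, contDiffOn_zero]
      exact ⟨fun t ht => (h t ht).1.continuousAt.continuousWithinAt,
        fun t ht => (h t ht).2.1.continuousAt.continuousWithinAt,
        fun t ht => (h t ht).2.2.continuousAt.continuousWithinAt⟩
    | succ k ih =>
      obtain ⟨ix, iy, iN⟩ := ih
      have ha' : ContDiffOn ℝ k a (Ioo (-T) T) := (ha.of_le (by exact_mod_cast le_top)).contDiffOn
      have hb' : ContDiffOn ℝ k b (Ioo (-T) T) := (hb.of_le (by exact_mod_cast le_top)).contDiffOn
      push_cast
      simp only [contDiffOn_succ_iff_deriv_of_isOpen isOpen_Ioo]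
      refine ⟨⟨fun t ht => (h t ht).1.differentiableAt.differentiableWithinAt, by simp, ?_⟩,
        ⟨fun t ht => (h t ht).2.1.differentiableAt.differentiableWithinAt, by simp, ?_⟩,
        ⟨fun t ht => (h t ht).2.2.differentiableAt.differentiableWithinAt, by simp, ?_⟩⟩
      · exact (ha'.mul iN).congr fun t ht => (h t ht).1.deriv
      · exact (hb'.mul iN).congr fun t ht => (h t ht).2.1.deriv
      · exact ((ha'.neg.mul ix).sub (hb'.mul iy)).congr fun t ht => (h t ht).2.2.deriv
  exact ⟨contDiffOn_infty.2 fun k => (key k).1, contDiffOn_infty.2 fun k => (key k).2.1,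
    contDiffOn_infty.2 fun k => (key k).2.2⟩

lemma rb_const (T : ℝ) (hT : 0 < T) (f : ℝ → ℝ) (hf : ∀ t ∈ Ioo (-T) T, HasDerivAt f 0 t)
    (t : ℝ) (ht : t ∈ Ioo (-T) T) : f t = f 0 := by
  refine isOpen_Ioo.is_const_of_deriv_eq_zero isPreconnected_Ioo
    (fun s hs => (hf s hs).differentiableAt.differentiableWithinAt)
    (fun s hs => (hf s hs).deriv) ht ⟨by linarith, hT⟩

open Matrix in
lemma rb_frame (T : ℝ) (hT : 0 < T) (a b : ℝ → ℝ) (ha : ContDiff ℝ (⊤ : ℕ∞) a)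
    (hb : ContDiff ℝ (⊤ : ℕ∞) b) :
    ∃ X Y N : Fin 3 → ℝ → ℝ, 
      (∀ i, ContDiffOn ℝ (⊤ : ℕ∞) (X i) (Ioo (-T) T) ∧ ContDiffOn ℝ (⊤ : ℕ∞) (Y i) (Ioo (-T) T) ∧
        ContDiffOn ℝ (⊤ : ℕ∞) (N i) (Ioo (-T) T)) ∧
      ∀ t ∈ Ioo (-T) T,
      (∀ i, HasDerivAt (X i) (a t * N i t) t ∧ HasDerivAt (Y i) (b t * N i t) t ∧
        HasDerivAt (N i) (-a t * X i t - b t * Y i t) t) ∧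
      (X 0 t ^ 2 + X 1 t ^ 2 + X 2 t ^ 2 = 1 ∧
       Y 0 t ^ 2 + Y 1 t ^ 2 + Y 2 t ^ 2 = 1 ∧
       N 0 t ^ 2 + N 1 t ^ 2 + N 2 t ^ 2 = 1 ∧
       X 0 t * Y 0 t + X 1 t * Y 1 t + X 2 t * Y 2 t = 0 ∧
       X 0 t * N 0 t + X 1 t * N 1 t + X 2 t * N 2 t = 0 ∧
       Y 0 t * N 0 t + Y 1 t * N 1 t + Y 2 t * N 2 t = 0 ∧
       X 1 t * Y 2 t - X 2 t * Y 1 t = N 0 t ∧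
       X 2 t * Y 0 t - X 0 t * Y 2 t = N 1 t ∧
       X 0 t * Y 1 t - X 1 t * Y 0 t = N 2 t) := by
  have hex : ∀ i : Fin 3, ∃ x y n : ℝ → ℝ, x 0 = (if i = 0 then 1 else 0) ∧
      y 0 = (if i = 1 then 1 else 0) ∧ n 0 = (if i = 2 then 1 else 0) ∧ ∀ t ∈ Ioo (-T) T,
      HasDerivAt x (a t * n t) t ∧ HasDerivAt y (b t * n t) t ∧
      HasDerivAt n (-a t * x t - b t * y t) t := by
    intro i
    apply rb_scalar T hT a b ha hb
    fin_cases i <;> simp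
  choose X Y N hX hY hN hd using hex
  refine ⟨X, Y, N, fun i => rb_smooth T a b ha hb _ _ _ (hd i), fun t ht => ⟨fun i => hd i t ht, ?_⟩⟩
  have hip : ∀ i j, X i t * X j t + Y i t * Y j t + N i t * N j t = if i = j then 1 else 0 := by
    intro i j
    have := rb_const T hT (fun t => X i t * X j t + Y i t * Y j t + N i t * N j t) (by
      intro s hs
      obtain ⟨h1, h2, h3⟩ := hd i s hs
      obtain ⟨k1, k2, k3⟩ := hd j s hs
      convert! ((h1.mul k1).add (h2.mul k2)).add (h3.mul k3) using 1
      ring) t ht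
    rw [this, hX, hX, hY, hY, hN, hN]
    fin_cases i <;> fin_cases j <;> simp
  have hdet : X 0 t * (Y 1 t * N 2 t - N 1 t * Y 2 t) - Y 0 t * (X 1 t * N 2 t - N 1 t * X 2 t)
      + N 0 t * (X 1 t * Y 2 t - Y 1 t * X 2 t) = 1 := by
    have := rb_const T hT (fun t => X 0 t * (Y 1 t * N 2 t - N 1 t * Y 2 t)
      - Y 0 t * (X 1 t * N 2 t - N 1 t * X 2 t)
      + N 0 t * (X 1 t * Y 2 t - Y 1 t * X 2 t)) (by
      intro s hs
      obtain ⟨h1, h2, h3⟩ := hd 0 s hs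
      obtain ⟨k1, k2, k3⟩ := hd 1 s hs
      obtain ⟨l1, l2, l3⟩ := hd 2 s hs
      convert! ((h1.mul ((k2.mul l3).sub (k3.mul l2))).sub
        (h2.mul ((k1.mul l3).sub (k3.mul l1)))).add
        (h3.mul ((k1.mul l2).sub (k2.mul l1))) using 1
      simp only [Pi.mul_apply, Pi.sub_apply]
      ring) t ht
    rw [this]
    simp [hX, hY, hN]
  let U : Matrix (Fin 3) (Fin 3) ℝ := Matrix.of fun i => ![X i t, Y i t, N i t]
  have hU : U * Uᵀ = 1 := by
    ext i j
    rw [Matrix.one_apply, ← hip i j]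
    simp [U, Matrix.mul_apply, Fin.sum_univ_three]
  have hU2 : Uᵀ * U = 1 := mul_eq_one_comm.1 hU
  have hd1 : U.det = 1 := by
    rw [Matrix.det_fin_three, ← hdet]
    simp [U]; ring
  have hadj : U.adjugate = Uᵀ := by
    calc U.adjugate = U.adjugate * (U * Uᵀ) := by rw [hU, mul_one]
      _ = (U.adjugate * U) * Uᵀ := by rw [mul_assoc]
      _ = Uᵀ := by rw [Matrix.adjugate_mul, hd1]; simp
  have e := fun i j => congrFun (congrFun hU2 i) j
  have f := fun i j => congrFun (congrFun hadj i) j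
  have e00 := e 0 0
  have e11 := e 1 1
  have e22 := e 2 2
  have e01 := e 0 1
  have e02 := e 0 2
  have e12 := e 1 2
  have f0 := f 2 0
  have f1 := f 2 1
  have f2 := f 2 2
  rw [Matrix.adjugate_fin_three] at f0 f1 f2
  simp [U, Matrix.mul_apply, Fin.sum_univ_three] at e00 e11 e22 e01 e02 e12 f0 f1 f2
  refine ⟨?_, ?_, ?_, ?_, ?_, ?_, ?_, ?_, ?_⟩ <;> linarith

lemma rb_ift (L : ℝ) (H : (ℝ × ℝ) × ℝ → ℝ) (hH : ContDiff ℝ (⊤ : ℕ∞) H)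
    (h0 : ∀ c ∈ Icc (0:ℝ) L, H ((c, 0), c) = 0)
    (h1 : ∀ c ∈ Icc (0:ℝ) L, fderiv ℝ H ((c, 0), c) (0, 1) ≠ 0) :
    ∃ (w : ℝ) (τ : ℝ × ℝ → ℝ), 0 < w ∧
      ContDiffOn ℝ (⊤ : ℕ∞) τ (Ioo 0 L ×ˢ Ioo (-(w/2)) (w/2)) ∧
      (∀ z ∈ Ioo 0 L ×ˢ Ioo (-(w/2)) (w/2), H (z, τ z) = 0 ∧ τ z ∈ Ioo (-(L+1)) (L+1)) ∧
      (∀ c ∈ Ioo 0 L, τ (c, 0) = c) := by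
  have htop : ((⊤ : ℕ∞) : WithTop ℕ∞) ≠ 0 := by simp
  have hinv : ∀ u, fderiv ℝ H u (0, 1) ≠ 0 →
      (fderiv ℝ H u ∘L .inr ℝ (ℝ × ℝ) ℝ).IsInvertible := by
    intro u hu
    refine ⟨ContinuousLinearEquiv.unitsEquivAut ℝ (Units.mk0 _ hu), ?_⟩
    ext; simp
  let K : Set ((ℝ × ℝ) × ℝ) := (fun c : ℝ => ((c, (0:ℝ)), c)) '' Icc 0 L
  have hK : IsCompact K := isCompact_Icc.image (by fun_prop)
  have loc : ∀ p ∈ K ×ˢ K, ∀ᶠ y in 𝓝 p, H y.1 = 0 → H y.2 = 0 → y.1.1 = y.2.1 → y.1 = y.2 := by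
    rintro ⟨p, q⟩ ⟨⟨c, hc, rfl⟩, ⟨d, hd, rfl⟩⟩
    rcases eq_or_ne c d with rfl | hne
    · have := (hH.contDiffAt (x := ((c, (0:ℝ)), c))).eventually_apply_eq_iff_implicitFunction htop
        (hinv _ (h1 c hc))
      rw [nhds_prod_eq]
      filter_upwards [this.prod_mk this] with y ⟨y1, y2⟩ e1 e2 e3
      rw [h0 c hc] at y1 y2
      refine Prod.ext e3 ?_
      rw [← y1.1 e1, ← y2.1 e2, e3]
    · have : ∀ᶠ y : ((ℝ × ℝ) × ℝ) × ((ℝ × ℝ) × ℝ) in 𝓝 ((((c, (0:ℝ)), c)), (((d, (0:ℝ)), d))),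
          y.1.1 ≠ y.2.1 := by
        have ho : IsOpen {y : ((ℝ × ℝ) × ℝ) × ((ℝ × ℝ) × ℝ) | y.1.1 ≠ y.2.1} :=
          isOpen_ne_fun (by fun_prop) (by fun_prop)
        exact ho.mem_nhds (by simp [hne])
      filter_upwards [this] with y hy _ _ e
      exact absurd e hy
  rw [← eventually_nhdsSet_iff_forall, hK.nhdsSet_prod_eq hK] at loc
  obtain ⟨V0, hV0, hV0'⟩ := (eventually_prod_self_iff (r := fun p q : (ℝ × ℝ) × ℝ =>
    H p = 0 → H q = 0 → p.1 = q.1 → p = q)).1 loc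
  obtain ⟨V1, hV1o, hKV1, hV1⟩ := mem_nhdsSet_iff_exists.1 hV0
  have hcd : Continuous fun u => fderiv ℝ H u (0, 1) :=
    (hH.continuous_fderiv htop).clm_apply continuous_const
  let V : Set ((ℝ × ℝ) × ℝ) := V1 ∩ {u | fderiv ℝ H u (0, 1) ≠ 0} ∩
    {u | u.2 ∈ Ioo (-(L+1)) (L+1)}
  have hVo : IsOpen V := (hV1o.inter (isOpen_ne_fun hcd continuous_const)).inter
    (isOpen_Ioo.preimage continuous_snd)
  have hKV : K ⊆ V := by
    intro u hu
    refine ⟨⟨hKV1 hu, ?_⟩, ?_⟩ <;> obtain ⟨c, hc, rfl⟩ := hu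
    · exact h1 c hc
    · exact ⟨by linarith [hc.1, hc.2], by linarith [hc.1, hc.2]⟩
  have huniq : ∀ z s t, (z, s) ∈ V → (z, t) ∈ V → H (z, s) = 0 → H (z, t) = 0 → s = t := by
    intro z s t hs ht e1 e2
    have := hV0' _ (hV1 hs.1.1) _ (hV1 ht.1.1) e1 e2 rfl
    exact congrArg Prod.snd this
  let W : Set (ℝ × ℝ) := {z | ∃ t, (z, t) ∈ V ∧ H (z, t) = 0}
  have himp : ∀ z t, (z, t) ∈ V → H (z, t) = 0 → ∃ ψ : ℝ × ℝ → ℝ, 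
      ContDiffAt ℝ (⊤ : ℕ∞) ψ z ∧ ∀ᶠ y in 𝓝 z, (y, ψ y) ∈ V ∧ H (y, ψ y) = 0 := by
    intro z t hz ht
    have hc := hH.contDiffAt (x := (z, t))
    have hi := hinv _ hz.1.2
    refine ⟨hc.implicitFunction htop hi, hc.contDiffAt_implicitFunction htop hi, ?_⟩
    have e1 := hc.eventually_apply_implicitFunction htop hi
    have e2 := hc.implicitFunction_apply_self htop hi
    have e3 := (hc.contDiffAt_implicitFunction htop hi).continuousAt
    simp only at e1 e2 e3
    have e4 : ContinuousAt (fun y => (y, hc.implicitFunction htop hi y)) z :=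
      continuousAt_id.prodMk e3
    have e5 := e4.eventually (hVo.mem_nhds (by simpa only [e2] using hz))
    filter_upwards [e1, e5] with y y1 y2
    exact ⟨y2, y1.trans ht⟩
  have hWo : IsOpen W := by
    rw [isOpen_iff_mem_nhds]
    rintro z ⟨t, hz, ht⟩
    obtain ⟨ψ, -, hψ⟩ := himp z t hz ht
    filter_upwards [hψ] with y hy
    exact ⟨_, hy⟩
  have hKW : Icc (0:ℝ) L ×ˢ {(0:ℝ)} ⊆ W := by
    rintro ⟨c, d⟩ ⟨hc, hd⟩
    rw [mem_singleton_iff] at hd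
    simp only at hc hd
    subst hd
    exact ⟨c, hKV ⟨c, hc, rfl⟩, h0 c hc⟩
  obtain ⟨u, v, huo, hvo, hu, hv, huv⟩ := generalized_tube_lemma (isCompact_Icc (a := (0:ℝ)) (b := L))
    (isCompact_singleton (x := (0:ℝ))) hWo hKW
  obtain ⟨ε, hε, hεv⟩ := Metric.isOpen_iff.1 hvo 0 (hv rfl)
  have hsub : Ioo 0 L ×ˢ Ioo (-(2*ε/2)) (2*ε/2) ⊆ W := by
    rintro ⟨c, d⟩ ⟨hc, hd⟩
    refine huv ⟨hu (Ioo_subset_Icc_self hc), hεv ?_⟩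
    simp only [Metric.mem_ball, dist_zero_right, Real.norm_eq_abs, abs_lt]
    constructor <;> linarith [hd.1, hd.2]
  have hch : ∀ z, ∃ t, z ∈ W → (z, t) ∈ V ∧ H (z, t) = 0 := by
    intro z
    by_cases h : z ∈ W
    · obtain ⟨t, ht⟩ := h
      exact ⟨t, fun _ => ht⟩
    · exact ⟨0, fun h' => absurd h' h⟩
  choose τ hτ using hch
  refine ⟨2 * ε, τ, by positivity, ?_, ?_, ?_⟩
  · intro z hz
    have hzW := hsub hz
    obtain ⟨h2, h3⟩ := hτ z hzW
    obtain ⟨ψ, hψ, hψ'⟩ := himp z _ h2 h3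
    refine (hψ.congr_of_eventuallyEq ?_).contDiffWithinAt
    filter_upwards [hψ', hWo.mem_nhds hzW] with y hy hyW
    exact huniq _ _ _ (hτ y hyW).1 hy.1 (hτ y hyW).2 hy.2
  · intro z hz
    obtain ⟨h2, h3⟩ := hτ z (hsub hz)
    exact ⟨h3, h2.2⟩
  · intro c hc
    have hc' := Ioo_subset_Icc_self hc
    obtain ⟨h2, h3⟩ := hτ (c, 0) (hKW ⟨hc', rfl⟩)
    exact huniq _ _ _ h2 (hKV ⟨c, hc', rfl⟩) h3 (h0 c hc')

lemma rb_pdv {f : ℝ × ℝ → Fin 3 → ℝ} {z : ℝ × ℝ} {D : Fin 3 → (ℝ × ℝ →L[ℝ] ℝ)}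
    (h : ∀ i, HasFDerivAt (fun z => f z i) (D i) z) (j : Fin 2) (i : Fin 3) :
    pdv j f z i = D i (E2 j) := by
  have := hasFDerivAt_pi.2 h
  rw [pdv, this.fderiv]; rfl

theorem stmt4 (L : ℝ) (hL : 0 < L) (κ : ℝ → ℝ) (hκ : ContDiff ℝ (⊤ : ℕ∞) κ)
    (A : ℝ → Matrix (Fin 2) (Fin 2) ℝ)
    (hA : ∀ i j : Fin 2, ContDiff ℝ (⊤ : ℕ∞) fun t => A t i j)
    (hAsymm : ∀ x ∈ Set.Icc (0 : ℝ) L, (A x).IsSymm)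
    (hAdet : ∀ x ∈ Set.Icc (0 : ℝ) L, (A x).det = 0)
    (hA11 : ∀ x ∈ Set.Icc (0 : ℝ) L, A x 0 0 ≠ 0) :
    ∃ (w : ℝ) (v : ℝ × ℝ → Fin 3 → ℝ), 0 < w ∧
      ContDiffOn ℝ (⊤ : ℕ∞) v (Set.Ioo 0 L ×ˢ Set.Ioo (-(w/2)) (w/2)) ∧
      (∀ z ∈ Set.Ioo 0 L ×ˢ Set.Ioo (-(w/2)) (w/2),
        pdv 0 v z ⬝ᵥ pdv 0 v z = (1 - κ z.1 * z.2) ^ 2 ∧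
        pdv 0 v z ⬝ᵥ pdv 1 v z = 0 ∧
        pdv 1 v z ⬝ᵥ pdv 1 v z = 1) ∧
      (∀ z₁ ∈ Set.Ioo (0 : ℝ) L, secondFF v (z₁, 0) = A z₁) := by
  obtain ⟨θ, hθ, hθ'⟩ := rb_prim κ hκ
  have hcs : ContDiff ℝ (⊤ : ℕ∞) (fun t => Real.cos (θ t)) := hθ.cos
  have hsn : ContDiff ℝ (⊤ : ℕ∞) (fun t => Real.sin (θ t)) := hθ.sin
  obtain ⟨p, hp, hp'⟩ := rb_prim _ hcs
  obtain ⟨q, hq, hq'⟩ := rb_prim _ hsn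
  have hcs' : ∀ t, HasDerivAt (fun t => Real.cos (θ t)) (-Real.sin (θ t) * κ t) t :=
    fun t => (hθ' t).cos
  have hsn' : ∀ t, HasDerivAt (fun t => Real.sin (θ t)) (Real.cos (θ t) * κ t) t :=
    fun t => (hθ' t).sin
  have hone : ∀ t, Real.sin (θ t) ^ 2 + Real.cos (θ t) ^ 2 = 1 :=
    fun t => Real.sin_sq_add_cos_sq _
  generalize hcdef : (fun t => Real.cos (θ t)) = cs at *
  generalize hsdef : (fun t => Real.sin (θ t)) = sn at *
  have hc1 : ∀ t, Real.cos (θ t) = cs t := fun t => by rw [← hcdef]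
  have hs1 : ∀ t, Real.sin (θ t) = sn t := fun t => by rw [← hsdef]
  simp only [hc1, hs1] at *
  -- frame coefficients
  obtain ⟨a, ha⟩ : ∃ a : ℝ → ℝ, a = fun t => A t 0 0 * cs t - A t 0 1 * sn t := ⟨_, rfl⟩
  obtain ⟨b, hb⟩ : ∃ b : ℝ → ℝ, b = fun t => A t 0 0 * sn t + A t 0 1 * cs t := ⟨_, rfl⟩
  have has : ContDiff ℝ (⊤ : ℕ∞) a := by
    rw [ha]; exact ((hA 0 0).mul hcs).sub ((hA 0 1).mul hsn)
  have hbs : ContDiff ℝ (⊤ : ℕ∞) b := by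
    rw [hb]; exact ((hA 0 0).mul hsn).add ((hA 0 1).mul hcs)
  have hab1 : ∀ t, a t * cs t + b t * sn t = A t 0 0 := by
    intro t; rw [ha, hb]; simp only; linear_combination A t 0 0 * hone t
  have hab2 : ∀ t, - a t * sn t + b t * cs t = A t 0 1 := by
    intro t; rw [ha, hb]; simp only; linear_combination A t 0 1 * hone t
  clear ha hb
  have had : ∀ t, HasDerivAt a (deriv a t) t := fun t =>
    (has.differentiable (by simp) t).hasDerivAt
  have hbd : ∀ t, HasDerivAt b (deriv b t) t := fun t =>
    (hbs.differentiable (by simp) t).hasDerivAt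
  have hT : 0 < L + 1 := by linarith
  obtain ⟨X, Y, N, hsm, hfr⟩ := rb_frame (L + 1) hT a b has hbs
  have hCex : ∀ i : Fin 3, ∃ F : ℝ → ℝ, ContDiffOn ℝ (⊤ : ℕ∞) F (Ioo (-(L+1)) (L+1)) ∧
      ∀ t ∈ Ioo (-(L+1)) (L+1), HasDerivAt F (-(p t * a t + q t * b t) * N i t) t := fun i =>
    rb_primOn (L + 1) hT (fun t => -(p t * a t + q t * b t) * N i t)
      ((((hp.mul has).add (hq.mul hbs)).neg.contDiffOn).mul (hsm i).2.2)
  choose C hCs hCd using hCex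
  -- planar ribbon
  obtain ⟨x, hx⟩ : ∃ x : ℝ × ℝ → ℝ, x = fun z => p z.1 - z.2 * sn z.1 := ⟨_, rfl⟩
  obtain ⟨y, hy⟩ : ∃ y : ℝ × ℝ → ℝ, y = fun z => q z.1 + z.2 * cs z.1 := ⟨_, rfl⟩
  have hxs : ContDiff ℝ (⊤ : ℕ∞) x := by
    rw [hx]; exact (hp.comp contDiff_fst).sub (contDiff_snd.mul (hsn.comp contDiff_fst))
  have hys : ContDiff ℝ (⊤ : ℕ∞) y := by
    rw [hy]; exact (hq.comp contDiff_fst).add (contDiff_snd.mul (hcs.comp contDiff_fst))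
  have hfst : ∀ z : ℝ × ℝ, HasFDerivAt (fun z : ℝ × ℝ => z.1) (ContinuousLinearMap.fst ℝ ℝ ℝ) z :=
    fun z => hasFDerivAt_fst
  have hsnd : ∀ z : ℝ × ℝ, HasFDerivAt (fun z : ℝ × ℝ => z.2) (ContinuousLinearMap.snd ℝ ℝ ℝ) z :=
    fun z => hasFDerivAt_snd
  have hxd : ∀ z, HasFDerivAt x (((1 - κ z.1 * z.2) * cs z.1) • ContinuousLinearMap.fst ℝ ℝ ℝ
      - sn z.1 • ContinuousLinearMap.snd ℝ ℝ ℝ) z := by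
    intro z
    rw [hx]
    convert! ((hp' z.1).comp_hasFDerivAt z (hfst z)).sub
      ((hsnd z).mul ((hsn' z.1).comp_hasFDerivAt z (hfst z))) using 1
    ext <;> simp
    ring
  have hyd : ∀ z, HasFDerivAt y (((1 - κ z.1 * z.2) * sn z.1) • ContinuousLinearMap.fst ℝ ℝ ℝ
      + cs z.1 • ContinuousLinearMap.snd ℝ ℝ ℝ) z := by
    intro z
    rw [hy]
    convert! ((hq' z.1).comp_hasFDerivAt z (hfst z)).add
      ((hsnd z).mul ((hcs' z.1).comp_hasFDerivAt z (hfst z))) using 1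
    ext <;> simp
    ring
  have hx0 : ∀ c, x (c, 0) = p c := by intro c; simp [hx]
  have hy0 : ∀ c, y (c, 0) = q c := by intro c; simp [hy]
  obtain ⟨w, τ, hw, hτs, hτH, hτ0⟩ := rb_ift L
    (fun u => (x u.1 - p u.2) * a u.2 + (y u.1 - q u.2) * b u.2)
    ((((hxs.comp contDiff_fst).sub (hp.comp contDiff_snd)).mul (has.comp contDiff_snd)).add
      (((hys.comp contDiff_fst).sub (hq.comp contDiff_snd)).mul (hbs.comp contDiff_snd)))
    (by intro c _; simp [hx0, hy0])
    (by
      intro c hc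
      have hdiff : ContDiff ℝ (⊤ : ℕ∞) (fun u : (ℝ × ℝ) × ℝ =>
          (x u.1 - p u.2) * a u.2 + (y u.1 - q u.2) * b u.2) :=
        ((((hxs.comp contDiff_fst).sub (hp.comp contDiff_snd)).mul (has.comp contDiff_snd)).add
          (((hys.comp contDiff_fst).sub (hq.comp contDiff_snd)).mul (hbs.comp contDiff_snd)))
      have h1 := (hdiff.differentiable (by simp) ((c, 0), c)).hasFDerivAt
      have hl : HasDerivAt (fun s : ℝ => (((c, 0), s) : (ℝ × ℝ) × ℝ)) (0, 1) c :=
        (hasDerivAt_const c ((c, 0) : ℝ × ℝ)).prodMk (hasDerivAt_id c)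
      have h2 := h1.comp_hasDerivAt c hl
      have h3 : HasDerivAt (fun s : ℝ => (x (c, 0) - p s) * a s + (y (c, 0) - q s) * b s)
          (-(A c 0 0)) c := by
        convert! ((((hp' c).const_sub (x (c, 0))).mul (had c))).add
          (((hq' c).const_sub (y (c, 0))).mul (hbd c)) using 1
        rw [hx0, hy0, ← hab1]; ring
      rw [h2.unique h3]
      exact neg_ne_zero.2 (hA11 c hc))
  set R := Ioo 0 L ×ˢ Ioo (-(w/2)) (w/2) with hR
  have hRo : IsOpen R := isOpen_Ioo.prod isOpen_Ioo
  have hτd : ∀ z ∈ R, HasFDerivAt τ (fderiv ℝ τ z) z := fun z hz =>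
    ((hτs.contDiffAt (hRo.mem_nhds hz)).differentiableAt (by simp)).hasFDerivAt
  obtain ⟨v, hv⟩ : ∃ v : ℝ × ℝ → Fin 3 → ℝ, v = fun z i =>
    C i (τ z) + x z * X i (τ z) + y z * Y i (τ z) := ⟨_, rfl⟩
  have hXc : ∀ z ∈ R, ∀ i, HasFDerivAt (fun z => X i (τ z))
      ((a (τ z) * N i (τ z)) • fderiv ℝ τ z) z := fun z hz i =>
    ((hfr _ (hτH z hz).2).1 i).1.comp_hasFDerivAt z (hτd z hz)
  have hYc : ∀ z ∈ R, ∀ i, HasFDerivAt (fun z => Y i (τ z))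
      ((b (τ z) * N i (τ z)) • fderiv ℝ τ z) z := fun z hz i =>
    ((hfr _ (hτH z hz).2).1 i).2.1.comp_hasFDerivAt z (hτd z hz)
  have hCc : ∀ z ∈ R, ∀ i, HasFDerivAt (fun z => C i (τ z))
      ((-(p (τ z) * a (τ z) + q (τ z) * b (τ z)) * N i (τ z)) • fderiv ℝ τ z) z := fun z hz i =>
    (hCd i _ (hτH z hz).2).comp_hasFDerivAt z (hτd z hz)
  have hvd : ∀ z ∈ R, ∀ i, HasFDerivAt (fun z => v z i)
      (((1 - κ z.1 * z.2) * (cs z.1 * X i (τ z) + sn z.1 * Y i (τ z))) •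
        ContinuousLinearMap.fst ℝ ℝ ℝ
      + (-sn z.1 * X i (τ z) + cs z.1 * Y i (τ z)) • ContinuousLinearMap.snd ℝ ℝ ℝ) z := by
    intro z hz i
    rw [hv]
    have hH := (hτH z hz).1
    simp only at hH
    convert! ((hCc z hz i).add ((hxd z).mul (hXc z hz i))).add
      ((hyd z).mul (hYc z hz i)) using 1
    ext <;> simp
    · linear_combination (-(N i (τ z)) * fderiv ℝ τ z (1, 0)) * hH
    · linear_combination (-(N i (τ z)) * fderiv ℝ τ z (0, 1)) * hH
  have hp0 : ∀ z ∈ R, ∀ i, pdv 0 v z i =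
      (1 - κ z.1 * z.2) * (cs z.1 * X i (τ z) + sn z.1 * Y i (τ z)) := by
    intro z hz i
    rw [rb_pdv (hvd z hz) 0 i]; simp [E2]
  have hp1 : ∀ z ∈ R, ∀ i, pdv 1 v z i = -sn z.1 * X i (τ z) + cs z.1 * Y i (τ z) := by
    intro z hz i
    rw [rb_pdv (hvd z hz) 1 i]; simp [E2]
  refine ⟨w, v, hw, ?_, ?_, ?_⟩
  · rw [contDiffOn_pi]
    intro i
    have hm : MapsTo τ R (Ioo (-(L+1)) (L+1)) := fun z hz => (hτH z hz).2
    rw [hv]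
    exact (((hCs i).comp hτs hm).add (hxs.contDiffOn.mul ((hsm i).1.comp hτs hm))).add
      (hys.contDiffOn.mul ((hsm i).2.1.comp hτs hm))
  · intro z hz
    obtain ⟨e1, e2, -, e3, -⟩ := (hfr _ (hτH z hz).2).2
    have h1 := hone z.1
    simp only [dotProduct, Fin.sum_univ_three, hp0 z hz, hp1 z hz]
    refine ⟨?_, ?_, ?_⟩
    · linear_combination (1 - κ z.1 * z.2) ^ 2 * (cs z.1 ^ 2 * e1 + sn z.1 ^ 2 * e2
        + 2 * cs z.1 * sn z.1 * e3 + h1)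
    · linear_combination (1 - κ z.1 * z.2) * (- cs z.1 * sn z.1 * e1 + cs z.1 * sn z.1 * e2
        + (cs z.1 ^ 2 - sn z.1 ^ 2) * e3)
    · linear_combination sn z.1 ^ 2 * e1 + cs z.1 ^ 2 * e2 - 2 * cs z.1 * sn z.1 * e3 + h1
  · intro c hc
    have hcI := Ioo_subset_Icc_self hc
    have hz : ((c, 0) : ℝ × ℝ) ∈ R := ⟨hc, by constructor <;> simp [hw]⟩
    have ht : τ (c, 0) = c := hτ0 c hc
    have hcT := (hτH _ hz).2
    rw [ht] at hcT
    obtain ⟨e1, e2, e3, e4, e5, e6, f0, f1, f2⟩ := (hfr c hcT).2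
    have h1 := hone c
    -- derivative of τ on the midline
    have hDτ : ∀ d : ℝ × ℝ, A c 0 0 * fderiv ℝ τ (c, 0) d = A c 0 0 * d.1 + A c 0 1 * d.2 := by
      intro d
      have k1 : HasFDerivAt (fun z => p (τ z)) _ (c, 0) :=
        (hp' (τ (c, 0))).comp_hasFDerivAt (c, 0) (hτd _ hz)
      have k2 : HasFDerivAt (fun z => q (τ z)) _ (c, 0) :=
        (hq' (τ (c, 0))).comp_hasFDerivAt (c, 0) (hτd _ hz)
      have k3 : HasFDerivAt (fun z => a (τ z)) _ (c, 0) :=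
        (had (τ (c, 0))).comp_hasFDerivAt (c, 0) (hτd _ hz)
      have k4 : HasFDerivAt (fun z => b (τ z)) _ (c, 0) :=
        (hbd (τ (c, 0))).comp_hasFDerivAt (c, 0) (hτd _ hz)
      have g1 := (((hxd (c, 0)).sub k1).mul k3).add (((hyd (c, 0)).sub k2).mul k4)
      have g2 := (hasFDerivAt_const (𝕜 := ℝ) (0:ℝ) ((c, 0) : ℝ × ℝ)).congr_of_eventuallyEq
        (f₁ := fun z => (x z - p (τ z)) * a (τ z) + (y z - q (τ z)) * b (τ z)) (by
          filter_upwards [hRo.mem_nhds hz] with z hz'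
          exact (hτH z hz').1)
      have g3 := DFunLike.congr_fun (g1.unique g2) d
      simp [ht, hx0, hy0] at g3
      rw [← hab1, ← hab2]
      linear_combination -g3
    have d0 := hDτ (1, 0)
    have d1 := hDτ (0, 1)
    simp at d0 d1
    have hD0 : fderiv ℝ τ (c, 0) (1, 0) = 1 := mul_left_cancel₀ (hA11 c hcI) (by rw [d0, mul_one])
    have hdet := hAdet c hcI
    rw [Matrix.det_fin_two] at hdet
    have hsy : A c 1 0 = A c 0 1 := (hAsymm c hcI).apply 0 1
    -- normal
    have hnu : ∀ i, nuv v (c, 0) i = N i c := by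
      have hcr : cross3 (pdv 0 v (c, 0)) (pdv 1 v (c, 0)) = fun i => N i c := by
        ext i
        fin_cases i <;> simp [cross3, hp0 _ hz, hp1 _ hz, ht]
        · linear_combination (sn c ^ 2 + cs c ^ 2) * f0 + N 0 c * h1
        · linear_combination (sn c ^ 2 + cs c ^ 2) * f1 + N 1 c * h1
        · linear_combination (sn c ^ 2 + cs c ^ 2) * f2 + N 2 c * h1
      intro i
      rw [nuv, hcr, norm3, Fin.sum_univ_three, e3]
      simp
    -- second derivatives
    have hcsf : HasFDerivAt (fun z : ℝ × ℝ => cs z.1)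
        ((-sn c * κ c) • ContinuousLinearMap.fst ℝ ℝ ℝ) (c, 0) :=
      HasDerivAt.comp_hasFDerivAt ((c, 0) : ℝ × ℝ) (hcs' c) (hfst (c, 0))
    have hsnf : HasFDerivAt (fun z : ℝ × ℝ => sn z.1)
        ((cs c * κ c) • ContinuousLinearMap.fst ℝ ℝ ℝ) (c, 0) :=
      HasDerivAt.comp_hasFDerivAt ((c, 0) : ℝ × ℝ) (hsn' c) (hfst (c, 0))
    have hκf : HasFDerivAt (fun z : ℝ × ℝ => κ z.1)
        (deriv κ c • ContinuousLinearMap.fst ℝ ℝ ℝ) (c, 0) :=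
      HasDerivAt.comp_hasFDerivAt ((c, 0) : ℝ × ℝ)
        (hκ.differentiable (by simp) c).hasDerivAt (hfst (c, 0))
    have hE0 : ∀ i, HasFDerivAt (fun z => pdv 0 v z i)
        ((κ c * (-sn c * X i c + cs c * Y i c)) • ContinuousLinearMap.fst ℝ ℝ ℝ
        + (-κ c * (cs c * X i c + sn c * Y i c)) • ContinuousLinearMap.snd ℝ ℝ ℝ
        + (A c 0 0 * N i c) • fderiv ℝ τ (c, 0)) (c, 0) := by
      intro i
      refine HasFDerivAt.congr_of_eventuallyEq (f := fun z =>
        (1 - κ z.1 * z.2) * (cs z.1 * X i (τ z) + sn z.1 * Y i (τ z))) ?_ (by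
          filter_upwards [hRo.mem_nhds hz] with z hz'
          exact hp0 z hz' i)
      convert! ((hκf.mul (hsnd (c, 0))).const_sub 1).mul
        ((hcsf.mul (hXc _ hz i)).add (hsnf.mul (hYc _ hz i))) using 1
      rw [← hab1]
      ext <;> simp [ht] <;> ring
    have hE1 : ∀ i, HasFDerivAt (fun z => pdv 1 v z i)
        ((-κ c * (cs c * X i c + sn c * Y i c)) • ContinuousLinearMap.fst ℝ ℝ ℝ
        + (A c 0 1 * N i c) • fderiv ℝ τ (c, 0)) (c, 0) := by
      intro i
      refine HasFDerivAt.congr_of_eventuallyEq (f := fun z =>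
        -sn z.1 * X i (τ z) + cs z.1 * Y i (τ z)) ?_ (by
          filter_upwards [hRo.mem_nhds hz] with z hz'
          exact hp1 z hz' i)
      convert! (hsnf.neg.mul (hXc _ hz i)).add (hcsf.mul (hYc _ hz i)) using 1
      rw [← hab2]
      ext <;> simp [ht] <;> ring
    have h00 := hA11 c hcI
    have hdot0 : ∀ j, pdv j (pdv 0 v) (c, 0) ⬝ᵥ nuv v (c, 0) =
        A c 0 0 * fderiv ℝ τ (c, 0) (E2 j) := by
      intro j
      simp only [dotProduct, Fin.sum_univ_three, hnu, rb_pdv hE0 j]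
      simp
      linear_combination
        (-κ c * sn c * (E2 j).1 - κ c * cs c * (E2 j).2) * e5 +
        (κ c * cs c * (E2 j).1 - κ c * sn c * (E2 j).2) * e6 +
        A c 0 0 * fderiv ℝ τ (c, 0) (E2 j) * e3
    have hdot1 : ∀ j, pdv j (pdv 1 v) (c, 0) ⬝ᵥ nuv v (c, 0) =
        A c 0 1 * fderiv ℝ τ (c, 0) (E2 j) := by
      intro j
      simp only [dotProduct, Fin.sum_univ_three, hnu, rb_pdv hE1 j]
      simp
      linear_combination
        (-κ c * cs c * (E2 j).1) * e5 + (-κ c * sn c * (E2 j).1) * e6 +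
        A c 0 1 * fderiv ℝ τ (c, 0) (E2 j) * e3
    ext i j
    fin_cases i <;> fin_cases j <;> simp [secondFF, hdot0, hdot1]
    · simp [E2, hD0]
    · simp [E2, hD0]
    · simp only [E2]
      simp
      rw [d1, hsy]
    · simp only [E2]
      simp
      apply mul_left_cancel₀ h00
      rw [hsy] at hdet
      linear_combination A c 0 1 * d1 - hdet
end
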